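/- arXiv:1312.4522 — 9 statements merged into one kernel-verified Lean document; each statement's English description precedes it below -/
import Mathlib

section
/- For every φ > 0, Ψ(φ) = inf{ s ≥ 1 : for all ρ, z ∈ [0,1], b_ρ(z) ≥ 0 implies α_ρ(z) ≥ ρ } and also Ψ(φ) = sup{ s ≥ 1 : there exist ρ, z ∈ [0,1] such that b_ρ(z) ≥ 0 and α_ρ(z) ≤ ρ }. -/
noncomputable section

/-- `Ψ(φ)` from the paper: `(1 + (1 - 1/√2)φ)²` for `φ ≤ √2 + 1` and `(1+2φ)/2` otherwise. -/
def Psi (φ : ℝ) : ℝ :=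
  if φ ≤ Real.sqrt 2 + 1 then (1 + (1 - 1 / Real.sqrt 2) * φ) ^ 2 else (1 + 2 * φ) / 2

/-- `α_ρ(z) = s z² / (ρ/2 + φ)` (depends on the parameters `s` and `φ`). -/
def alphaRho (s φ ρ z : ℝ) : ℝ := s * z ^ 2 / (ρ / 2 + φ)

/-- The condition `b_ρ(z) ≥ 0`, where `b_ρ(z) = 1 - ρ - s(1-z)²/(1-ρ)` for `ρ ∈ [0,1)`,
with the convention `b₁(1) = 0`, `b₁(z) = -∞` for `z ≠ 1`, so that at `ρ = 1`
the condition `b_ρ(z) ≥ 0` holds iff `z = 1`. -/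
def bNonneg (s ρ z : ℝ) : Prop :=
  if ρ = 1 then z = 1 else 0 ≤ 1 - ρ - s * (1 - z) ^ 2 / (1 - ρ)

/-- On `ρ, z ≤ 1`, the condition `b_ρ(z) ≥ 0` is linear in terms of `r = √s`. -/
lemma bNonneg_sq_iff {r ρ z : ℝ} (hr : 1 ≤ r) (hρ : ρ ≤ 1) (hz : z ≤ 1) :
    bNonneg (r ^ 2) ρ z ↔ r * (1 - z) ≤ 1 - ρ := by
  unfold bNonneg
  split_ifs with h
  · subst h
    constructor
    · rintro rfl
      simp
    · intro h
      nlinarith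
  · have h1 : 0 < 1 - ρ := sub_pos.2 (lt_of_le_of_ne hρ h)
    have h2 : 0 ≤ r * (1 - z) := mul_nonneg (by linarith) (by linarith)
    rw [sub_nonneg, div_le_iff₀ h1, ← mul_pow, ← sq, pow_le_pow_iff_left₀ h2 h1.le two_ne_zero]

lemma le_alphaRho_sq_iff {r φ ρ z : ℝ} (hφ : 0 < φ) (hρ : 0 ≤ ρ) :
    ρ ≤ alphaRho (r ^ 2) φ ρ z ↔ ρ * (ρ / 2 + φ) ≤ (r * z) ^ 2 := by
  rw [alphaRho, le_div_iff₀ (by positivity), mul_pow]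

lemma alphaRho_sq_le_iff {r φ ρ z : ℝ} (hφ : 0 < φ) (hρ : 0 ≤ ρ) :
    alphaRho (r ^ 2) φ ρ z ≤ ρ ↔ (r * z) ^ 2 ≤ ρ * (ρ / 2 + φ) := by
  rw [alphaRho, div_le_iff₀ (by positivity), mul_pow]

/-- `√Ψ(φ) - 1` is the maximum over `ρ ∈ [0,1]` of `√(ρ (ρ / 2 + φ)) - ρ`. -/
lemma exists_Psi_eq_sq {φ : ℝ} (hφ : 0 < φ) :
    ∃ t : ℝ, 0 ≤ t ∧ Psi φ = (1 + t) ^ 2 ∧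
      (∀ ρ ∈ Set.Icc (0 : ℝ) 1, ρ * (ρ / 2 + φ) ≤ (t + ρ) ^ 2) ∧
      ∃ ρ ∈ Set.Icc (0 : ℝ) 1, ρ * (ρ / 2 + φ) = (t + ρ) ^ 2 := by
  have h2 : √2 ^ 2 = (2 : ℝ) := Real.sq_sqrt (by norm_num)
  have h1 : 1 < √2 := by rw [Real.lt_sqrt] <;> norm_num
  unfold Psi
  split_ifs with h
  · have hc : 1 - 1 / √2 = 1 - √2 / 2 := by
      have : √2 ≠ 0 := by positivity
      field_simp
      linarith
    have hlt : √2 < 2 := by nlinarith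
    rw [hc]
    refine ⟨(1 - √2 / 2) * φ, mul_nonneg (by linarith) hφ.le, rfl, fun ρ _ => ?_,
      (√2 - 1) * φ, ⟨mul_nonneg (by linarith) hφ.le, by nlinarith⟩, ?_⟩
    · linear_combination sq_nonneg ((1 - √2 / 2) * φ - √2 / 2 * ρ) +
        (ρ ^ 2 / 4 + ρ * φ / 2) * h2
    · linear_combination (φ ^ 2 / 4) * h2
  · have hsq : √(1 / 2 + φ) ^ 2 = 1 / 2 + φ := Real.sq_sqrt (by positivity)
    have hle : 1 + √2 / 2 ≤ √(1 / 2 + φ) := by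
      apply Real.le_sqrt_of_sq_le
      nlinarith
    refine ⟨√(1 / 2 + φ) - 1, by linarith, by linarith, fun ρ hρ => ?_,
      1, by simp, by linarith⟩
    have ht : 1 / 2 ≤ (√(1 / 2 + φ) - 1) ^ 2 := by nlinarith
    have := mul_nonneg (sub_nonneg.2 hρ.2)
      (show 0 ≤ (√(1 / 2 + φ) - 1) ^ 2 - ρ / 2 by linarith [hρ.2])
    linear_combination this - ρ * hsq

/-- Lemma 1.5 (variational representations of `Ψ`): for every `φ > 0`,
`Ψ(φ) = inf{s ≥ 1 : ∀ ρ, z ∈ [0,1], b_ρ(z) ≥ 0 ⟹ α_ρ(z) ≥ ρ}`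
and `Ψ(φ) = sup{s ≥ 1 : ∃ ρ, z ∈ [0,1], b_ρ(z) ≥ 0 and α_ρ(z) ≤ ρ}`. -/
theorem psi_variational (φ : ℝ) (hφ : 0 < φ) :
    Psi φ = sInf {s : ℝ | 1 ≤ s ∧ ∀ ρ ∈ Set.Icc (0:ℝ) 1, ∀ z ∈ Set.Icc (0:ℝ) 1,
        bNonneg s ρ z → ρ ≤ alphaRho s φ ρ z} ∧
    Psi φ = sSup {s : ℝ | 1 ≤ s ∧ ∃ ρ ∈ Set.Icc (0:ℝ) 1, ∃ z ∈ Set.Icc (0:ℝ) 1,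
        bNonneg s ρ z ∧ alphaRho s φ ρ z ≤ ρ} := by
  obtain ⟨t, ht, hPsi, hmax, ρ₀, hρ₀, heq⟩ := exists_Psi_eq_sq hφ
  have hsqrt : ∀ s : ℝ, 1 ≤ s → ∃ r, 1 ≤ r ∧ s = r ^ 2 := fun s hs =>
    ⟨√s, Real.one_le_sqrt.2 hs, (Real.sq_sqrt (by linarith)).symm⟩
  have hone : (1 : ℝ) ≤ (1 + t) ^ 2 := by nlinarith
  -- for each `r = √s`, the smallest `z` with `b_ρ₀(z) ≥ 0`
  have hwit : ∀ r : ℝ, 1 ≤ r → ∃ z ∈ Set.Icc (0 : ℝ) 1,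
      bNonneg (r ^ 2) ρ₀ z ∧ r * z = r - 1 + ρ₀ := by
    intro r hr
    have hr0 : 0 < r := by linarith
    have hmul : r * (1 - (1 - ρ₀) / r) = r - 1 + ρ₀ := by
      field_simp
      ring
    have hz1 : 1 - (1 - ρ₀) / r ≤ 1 :=
      sub_le_self _ (div_nonneg (sub_nonneg.2 hρ₀.2) hr0.le)
    refine ⟨1 - (1 - ρ₀) / r, ⟨?_, hz1⟩, ?_, hmul⟩
    · rw [sub_nonneg, div_le_one hr0]
      linarith [hρ₀.1]
    · rw [bNonneg_sq_iff hr hρ₀.2 hz1]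
      linarith
  rw [hPsi]
  constructor
  · refine Eq.symm (IsLeast.csInf_eq (And.intro ⟨hone, fun ρ hρ z hz hb => ?_⟩ ?_))
    · rw [bNonneg_sq_iff (by linarith) hρ.2 hz.2] at hb
      rw [le_alphaRho_sq_iff hφ hρ.1]
      exact (hmax ρ hρ).trans
        (pow_le_pow_left₀ (add_nonneg ht hρ.1) (by linarith) 2)
    · rintro s ⟨hs, H⟩
      obtain ⟨r, hr, rfl⟩ := hsqrt s hs
      obtain ⟨z, hz, hb, hrz⟩ := hwit r hr
      have h := H ρ₀ hρ₀ z hz hb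
      rw [le_alphaRho_sq_iff hφ hρ₀.1, hrz, heq] at h
      have h' := (sq_le_sq₀ (add_nonneg ht hρ₀.1) (by linarith [hρ₀.1])).1 h
      exact pow_le_pow_left₀ (by linarith) (by linarith) 2
  · refine Eq.symm (IsGreatest.csSup_eq (And.intro ⟨hone, ρ₀, hρ₀, ?_⟩ ?_))
    · obtain ⟨z, hz, hb, hrz⟩ := hwit (1 + t) (by linarith)
      refine ⟨z, hz, hb, ?_⟩
      rw [alphaRho_sq_le_iff hφ hρ₀.1, hrz, heq]
      exact le_of_eq (by ring)
    · rintro s ⟨hs, ρ, hρ, z, hz, hb, ha⟩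
      obtain ⟨r, hr, rfl⟩ := hsqrt s hs
      rw [bNonneg_sq_iff hr hρ.2 hz.2] at hb
      rw [alphaRho_sq_le_iff hφ hρ.1] at ha
      have h := (le_abs_self _).trans
        (abs_le_of_sq_le_sq (ha.trans (hmax ρ hρ)) (add_nonneg ht hρ.1))
      exact pow_le_pow_left₀ (by linarith) (by linarith) 2
end
end

section
/- For every φ > 0, sup over ρ ∈ [0,1] of ( √(ρ(φ + ρ/2)) + 1 − ρ ) equals √(Ψ(φ)). Moreover, when φ ≤ 1/(√2 − 1) the supremum is attained at ρ = (√2 − 1)φ, and when φ > 1/(√2 − 1) it is attained at ρ = 1. -/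
noncomputable section

theorem one_div_sqrt_two_sub_one : 1 / (Real.sqrt 2 - 1) = Real.sqrt 2 + 1 := by
  have hs : Real.sqrt 2 ^ 2 = 2 := Real.sq_sqrt (by norm_num)
  have h1 : (1 : ℝ) < Real.sqrt 2 := Real.one_lt_sqrt_two
  rw [div_eq_iff (by linarith)]
  linarith

theorem sqrt_Psi_of_le {φ : ℝ} (hφ : 0 < φ) (h : φ ≤ Real.sqrt 2 + 1) :
    Real.sqrt (Psi φ) = 1 + (1 - Real.sqrt 2 / 2) * φ := by
  have h2 : Real.sqrt 2 < 2 := Real.sqrt_two_lt_three_halves.trans (by norm_num)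
  have hinv : 1 / Real.sqrt 2 = Real.sqrt 2 / 2 := Real.sqrt_div_self'.symm
  have hpos : 0 < (1 - Real.sqrt 2 / 2) * φ := mul_pos (by linarith) hφ
  rw [Psi, if_pos h, hinv, Real.sqrt_sq (by linarith)]

theorem sqrt_Psi_of_lt {φ : ℝ} (h : Real.sqrt 2 + 1 < φ) :
    Real.sqrt (Psi φ) = Real.sqrt (φ + 1 / 2) := by
  rw [Psi, if_neg h.not_ge]
  congr 1
  ring

theorem objective_at_critical_point {φ : ℝ} (hφ : 0 < φ) :
    Real.sqrt ((Real.sqrt 2 - 1) * φ * (φ + (Real.sqrt 2 - 1) * φ / 2)) + 1 -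
      (Real.sqrt 2 - 1) * φ = 1 + (1 - Real.sqrt 2 / 2) * φ := by
  have hs : Real.sqrt 2 ^ 2 = 2 := Real.sq_sqrt (by norm_num)
  have h : (Real.sqrt 2 - 1) * φ * (φ + (Real.sqrt 2 - 1) * φ / 2) =
      (Real.sqrt 2 / 2 * φ) ^ 2 := by
    linear_combination (φ ^ 2 / 4) * hs
  rw [h, Real.sqrt_sq (by positivity)]
  ring

theorem objective_le_linear {φ ρ : ℝ} (hφ : 0 < φ) (hρ : 0 ≤ ρ) :
    Real.sqrt (ρ * (φ + ρ / 2)) + 1 - ρ ≤ 1 + (1 - Real.sqrt 2 / 2) * φ := by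
  have hs : Real.sqrt 2 ^ 2 = 2 := Real.sq_sqrt (by norm_num)
  have h2 : Real.sqrt 2 < 2 := Real.sqrt_two_lt_three_halves.trans (by norm_num)
  have hpos : 0 < (1 - Real.sqrt 2 / 2) * φ := mul_pos (by linarith) hφ
  have h : Real.sqrt (ρ * (φ + ρ / 2)) ≤ (1 - Real.sqrt 2 / 2) * φ + ρ := by
    refine Real.sqrt_le_iff.mpr ⟨by linarith, ?_⟩
    have key : ((1 - Real.sqrt 2 / 2) * φ + ρ) ^ 2 - ρ * (φ + ρ / 2) =
        (ρ - (Real.sqrt 2 - 1) * φ) ^ 2 / 2 := by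
      linear_combination (-φ ^ 2 / 4) * hs
    linarith [sq_nonneg (ρ - (Real.sqrt 2 - 1) * φ)]
  linarith

theorem objective_le_at_one {φ ρ : ℝ} (h : Real.sqrt 2 + 1 < φ) (hρ : 0 ≤ ρ) (hρ1 : ρ ≤ 1) :
    Real.sqrt (ρ * (φ + ρ / 2)) + 1 - ρ ≤ Real.sqrt (φ + 1 / 2) := by
  have hs : Real.sqrt 2 ^ 2 = 2 := Real.sq_sqrt (by norm_num)
  have hs0 : 0 ≤ Real.sqrt 2 := Real.sqrt_nonneg 2
  have hq : 1 + Real.sqrt 2 / 2 ≤ Real.sqrt (φ + 1 / 2) := by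
    apply Real.le_sqrt_of_sq_le
    linarith
  have hqq : Real.sqrt (φ + 1 / 2) ^ 2 = φ + 1 / 2 := Real.sq_sqrt (by linarith)
  set q := Real.sqrt (φ + 1 / 2)
  have hfac : 0 ≤ q ^ 2 - 2 * q + 1 / 2 := by
    have := pow_le_pow_left₀ (by linarith) (show Real.sqrt 2 / 2 ≤ q - 1 by linarith) 2
    linarith
  have hsqrt : Real.sqrt (ρ * (φ + ρ / 2)) ≤ q - 1 + ρ := by
    refine Real.sqrt_le_iff.mpr ⟨by linarith, ?_⟩
    have key : (q - 1 + ρ) ^ 2 - ρ * (φ + ρ / 2) =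
        (1 - ρ) * (q ^ 2 - 2 * q + 1 / 2 + (1 - ρ) / 2) := by
      linear_combination ρ * hqq
    have : 0 ≤ (1 - ρ) * (q ^ 2 - 2 * q + 1 / 2 + (1 - ρ) / 2) :=
      mul_nonneg (by linarith) (by linarith)
    linarith
  linarith

/-- For every `φ > 0`, `sup_{ρ ∈ [0,1]} ( √(ρ(φ + ρ/2)) + 1 - ρ ) = √(Ψ(φ))`; the supremum
is attained at `ρ = (√2 - 1)φ` when `φ ≤ 1/(√2 - 1)`, and at `ρ = 1` when `φ > 1/(√2 - 1)`. -/
theorem sup_attained (φ : ℝ) (hφ : 0 < φ) :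
    sSup ((fun ρ : ℝ => Real.sqrt (ρ * (φ + ρ / 2)) + 1 - ρ) '' Set.Icc (0:ℝ) 1) =
      Real.sqrt (Psi φ) ∧
    (φ ≤ 1 / (Real.sqrt 2 - 1) →
      Real.sqrt ((Real.sqrt 2 - 1) * φ * (φ + (Real.sqrt 2 - 1) * φ / 2)) + 1 -
          (Real.sqrt 2 - 1) * φ = Real.sqrt (Psi φ)) ∧
    (1 / (Real.sqrt 2 - 1) < φ →
      Real.sqrt (1 * (φ + 1 / 2)) + 1 - 1 = Real.sqrt (Psi φ)) := by
  have h1 : (1 : ℝ) < Real.sqrt 2 := Real.one_lt_sqrt_two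
  have hrec := one_div_sqrt_two_sub_one
  refine ⟨IsGreatest.csSup_eq ?_, fun h => ?_, fun h => ?_⟩
  · rcases le_or_gt φ (Real.sqrt 2 + 1) with h | h
    · rw [sqrt_Psi_of_le hφ h]
      refine ⟨⟨(Real.sqrt 2 - 1) * φ, ⟨mul_nonneg (by linarith) hφ.le, ?_⟩,
        objective_at_critical_point hφ⟩, ?_⟩
      · rw [← hrec, le_div_iff₀ (by linarith)] at h
        linarith
      · rintro _ ⟨ρ, hρ, rfl⟩
        exact objective_le_linear hφ hρ.1
    · rw [sqrt_Psi_of_lt h]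
      refine ⟨⟨1, ⟨zero_le_one, le_rfl⟩, by simp⟩, ?_⟩
      rintro _ ⟨ρ, hρ, rfl⟩
      exact objective_le_at_one h hρ.1 hρ.2
  · rw [sqrt_Psi_of_le hφ (hrec ▸ h), objective_at_critical_point hφ]
  · rw [sqrt_Psi_of_lt (hrec ▸ h), one_mul, add_sub_cancel_right]
end
end

section
/- Let G = (V,E) be a finite connected graph, o ∈ V a vertex of degree d_o, X = (X_n) the simple random walk on G started at o, and T a geometric random variable with values in {0,1,2,…} (i.e. P[T ≥ k] = t^k for some t ∈ (0,1)) independent of X. Then there exists a flow θ on G whose divergence at every v ∈ V equals 1_{v=o} − P[X_T = v], and whose Dirichlet energy satisfies D(θ) ≤ (1/d_o) · E[ Σ_{n=0}^{T} 1{X_n = o} ]. -/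
noncomputable section

variable {V : Type*} [Fintype V] [DecidableEq V]

/-- Transition matrix of the simple random walk on `G`:
`P(x,y) = 1/deg(x)` if `x ∼ y`, and `0` otherwise. -/
def srwMatrix (G : SimpleGraph V) [DecidableRel G.Adj] : Matrix V V ℝ :=
  Matrix.of fun x y => if G.Adj x y then (1 : ℝ) / (G.degree x : ℝ) else 0

/-- `P[X_T = v]` for the SRW `X` started at `o` and `T` an independent geometric time with
`P[T ≥ k] = t^k`: equals `(1-t) Σ_n t^n Pⁿ(o,v)`. -/
def geometricStopLaw (G : SimpleGraph V) [DecidableRel G.Adj] (o : V) (t : ℝ) (v : V) : ℝ :=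
  (1 - t) * ∑' n : ℕ, t ^ n * (srwMatrix G ^ n) o v

/-- `E[ Σ_{n=0}^T 1{X_n = o} ]` for the SRW `X` started at `o` and `T` an independent geometric
time with `P[T ≥ k] = t^k`: equals `Σ_n t^n Pⁿ(o,o)`. -/
def expectedLocalTime (G : SimpleGraph V) [DecidableRel G.Adj] (o : V) (t : ℝ) : ℝ :=
  ∑' n : ℕ, t ^ n * (srwMatrix G ^ n) o o

lemma srwMatrix_apply {W : Type*} [Fintype W] (G : SimpleGraph W) [DecidableRel G.Adj] (x y : W) :
    srwMatrix G x y = if G.Adj x y then (1 : ℝ) / (G.degree x : ℝ) else 0 := rfl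

lemma srwMatrix_pow_nonneg (G : SimpleGraph V) [DecidableRel G.Adj] (n : ℕ) (x y : V) :
    0 ≤ (srwMatrix G ^ n) x y := by
  induction n generalizing y with
  | zero =>
    rw [pow_zero, Matrix.one_apply]
    split_ifs <;> norm_num
  | succ n ih =>
    rw [pow_succ, Matrix.mul_apply]
    refine Finset.sum_nonneg fun z _ => mul_nonneg (ih z) ?_
    rw [srwMatrix_apply]
    split_ifs <;> positivity

lemma sum_srwMatrix {W : Type*} [Fintype W] (G : SimpleGraph W) [DecidableRel G.Adj] (x : W) :
    ∑ y, srwMatrix G x y = (G.degree x : ℝ) / G.degree x := by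
  simp only [srwMatrix_apply]
  rw [← Finset.sum_filter, Finset.sum_const, ← SimpleGraph.neighborFinset_eq_filter,
    SimpleGraph.card_neighborFinset_eq_degree, nsmul_eq_mul, mul_one_div]

lemma sum_srwMatrix_le_one {W : Type*} [Fintype W] (G : SimpleGraph W) [DecidableRel G.Adj]
    (x : W) :
    ∑ y, srwMatrix G x y ≤ 1 :=
  (sum_srwMatrix G x).trans_le (div_self_le_one _)

lemma sum_srwMatrix_pow_le_one (G : SimpleGraph V) [DecidableRel G.Adj] (n : ℕ) (x : V) :
    ∑ y, (srwMatrix G ^ n) x y ≤ 1 := by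
  induction n with
  | zero => simp [Matrix.one_apply]
  | succ n ih =>
    simp only [pow_succ, Matrix.mul_apply]
    rw [Finset.sum_comm]
    simp only [← Finset.mul_sum]
    refine le_trans (Finset.sum_le_sum fun z _ => ?_) ih
    exact mul_le_of_le_one_right (srwMatrix_pow_nonneg G n x z) (sum_srwMatrix_le_one G z)

lemma srwMatrix_pow_le_one (G : SimpleGraph V) [DecidableRel G.Adj] (n : ℕ) (x y : V) :
    (srwMatrix G ^ n) x y ≤ 1 :=
  (Finset.single_le_sum (f := fun y => (srwMatrix G ^ n) x y)
    (fun z _ => srwMatrix_pow_nonneg G n x z) (Finset.mem_univ y)).trans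
    (sum_srwMatrix_pow_le_one G n x)

/-- The Green function `∑ₙ tⁿ Pⁿ(o,v)` of the walk killed at rate `1 - t`. -/
def killedGreen (G : SimpleGraph V) [DecidableRel G.Adj] (o : V) (t : ℝ) (v : V) : ℝ :=
  ∑' n : ℕ, t ^ n * (srwMatrix G ^ n) o v

lemma summable_killedGreen (G : SimpleGraph V) [DecidableRel G.Adj] (o : V) {t : ℝ}
    (ht : t ∈ Set.Ioo (0 : ℝ) 1) (v : V) :
    Summable fun n : ℕ => t ^ n * (srwMatrix G ^ n) o v :=
  Summable.of_nonneg_of_le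
    (fun n => mul_nonneg (pow_nonneg ht.1.le n) (srwMatrix_pow_nonneg G n o v))
    (fun n => mul_le_of_le_one_right (pow_nonneg ht.1.le n) (srwMatrix_pow_le_one G n o v))
    (summable_geometric_of_lt_one ht.1.le ht.2)

lemma killedGreen_nonneg (G : SimpleGraph V) [DecidableRel G.Adj] (o : V) {t : ℝ}
    (ht : t ∈ Set.Ioo (0 : ℝ) 1) (v : V) : 0 ≤ killedGreen G o t v :=
  tsum_nonneg fun n => mul_nonneg (pow_nonneg ht.1.le n) (srwMatrix_pow_nonneg G n o v)

lemma killedGreen_eq (G : SimpleGraph V) [DecidableRel G.Adj] (o : V) {t : ℝ}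
    (ht : t ∈ Set.Ioo (0 : ℝ) 1) (v : V) :
    killedGreen G o t v =
      (if v = o then 1 else 0) + t * ∑ u, killedGreen G o t u * srwMatrix G u v := by
  have hstep : ∀ n : ℕ, t ^ (n + 1) * (srwMatrix G ^ (n + 1)) o v =
      ∑ u, t * (t ^ n * (srwMatrix G ^ n) o u * srwMatrix G u v) := fun n => by
    rw [pow_succ (srwMatrix G), Matrix.mul_apply, Finset.mul_sum]
    exact Finset.sum_congr rfl fun u _ => by ring
  rw [killedGreen, (summable_killedGreen G o ht v).tsum_eq_zero_add, tsum_congr hstep,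
    Summable.tsum_finsetSum fun u _ =>
      ((summable_killedGreen G o ht u).mul_right _).mul_left t, Finset.mul_sum]
  simp only [tsum_mul_left, tsum_mul_right, pow_zero, one_mul, Matrix.one_apply, eq_comm (a := o)]
  rfl

/-- The energy of a gradient flow is the sum of potential times divergence. -/
lemma energy_eq_sum_potential_mul_div {W : Type*} [Fintype W] {θ : W → W → ℝ} {f : W → ℝ}
    (hanti : ∀ u v, θ u v = -θ v u) (hgrad : ∀ u v, θ u v ^ 2 = (f u - f v) * θ u v) :
    (1 / 2) * ∑ u, ∑ v, θ u v ^ 2 = ∑ u, f u * ∑ v, θ u v := by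
  have hswap : ∑ u, ∑ v, f v * θ u v = -∑ u, ∑ v, f u * θ u v := by
    rw [Finset.sum_comm, ← Finset.sum_neg_distrib]
    refine Finset.sum_congr rfl fun u _ => ?_
    rw [← Finset.sum_neg_distrib]
    exact Finset.sum_congr rfl fun v _ => by rw [hanti v u]; ring
  simp only [hgrad, sub_mul, Finset.sum_sub_distrib, hswap, Finset.mul_sum]
  ring

/-- Lemma 2.3: for SRW `X` on a finite connected graph `G` started at `o`, independent of a
geometric variable `T`, there is a flow `θ` with unit current source at `o` and current
`P[X_T = v]` reaching each `v`, whose Dirichlet energy is at most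
`(1/d_o) E[Σ_{n=0}^T 1{X_n = o}]`. -/
theorem flow_from_geometric_stopping [Nontrivial V]
    (G : SimpleGraph V) [DecidableRel G.Adj] (hG : G.Connected)
    (o : V) (t : ℝ) (ht : t ∈ Set.Ioo (0:ℝ) 1) :
    ∃ θ : V → V → ℝ,
      (∀ u v, θ u v = -θ v u) ∧
      (∀ u v, ¬ G.Adj u v → θ u v = 0) ∧
      (∀ v : V, (∑ u : V, θ v u) =
        (if v = o then (1:ℝ) else 0) - geometricStopLaw G o t v) ∧
      (1 / 2) * ∑ u : V, ∑ v : V, θ u v ^ 2 ≤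
        (1 / (G.degree o : ℝ)) * expectedLocalTime G o t := by
  have hdeg : ∀ v, (G.degree v : ℝ) ≠ 0 := fun v =>
    Nat.cast_ne_zero.mpr (hG.preconnected.degree_pos_of_nontrivial v).ne'
  let g := killedGreen G o t
  let h : V → ℝ := fun v => g v / G.degree v
  have hg0 : ∀ v, 0 ≤ g v := killedGreen_nonneg G o ht
  have hh0 : ∀ v, 0 ≤ h v := fun v => div_nonneg (hg0 v) (Nat.cast_nonneg _)
  let θ : V → V → ℝ := fun u v => if G.Adj u v then t * h u - t * h v else 0
  have hanti : ∀ u v, θ u v = -θ v u := fun u v => by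
    simp only [θ, G.adj_comm v u]
    split_ifs <;> ring
  have hdiv : ∀ v, ∑ u, θ v u = (if v = o then (1 : ℝ) else 0) - (1 - t) * g v := fun v => by
    have hsplit : ∀ u, θ v u =
        t * (g v * srwMatrix G v u) - t * (g u * srwMatrix G u v) := fun u => by
      simp only [θ, h, srwMatrix_apply, G.adj_comm u v]
      split_ifs <;> ring
    have hrow : ∑ u, srwMatrix G v u = 1 :=
      (sum_srwMatrix G v).trans (div_self (hdeg v))
    simp only [hsplit, Finset.sum_sub_distrib, ← Finset.mul_sum, hrow]
    linarith [killedGreen_eq G o ht v]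
  refine ⟨θ, hanti, fun u v huv => if_neg huv, hdiv, ?_⟩
  have hgrad : ∀ u v, θ u v ^ 2 = (t * h u - t * h v) * θ u v := fun u v => by
    simp only [θ]
    split_ifs <;> ring
  calc (1 / 2) * ∑ u, ∑ v, θ u v ^ 2
      = ∑ u, t * h u * ∑ v, θ u v :=
        energy_eq_sum_potential_mul_div (f := fun v => t * h v) hanti hgrad
    _ ≤ ∑ u, t * h u * (if u = o then 1 else 0) := by
        refine Finset.sum_le_sum fun u _ =>
          mul_le_mul_of_nonneg_left ?_ (mul_nonneg ht.1.le (hh0 u))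
        rw [hdiv]
        linarith [mul_nonneg (sub_nonneg.mpr ht.2.le) (hg0 u)]
    _ = t * h o := by simp
    _ ≤ h o := mul_le_of_le_one_left (hh0 o) ht.2.le
    _ = (1 / (G.degree o : ℝ)) * expectedLocalTime G o t := by
        rw [one_div_mul_eq_div]
        rfl
end
end

section
/- There exists a constant C < ∞ such that for every integer M ≥ 2, every S' ≥ 1 with S = M S', and every positive function f on the discrete ball B(0,S) ⊂ ℤ³ that is discrete-harmonic on B(0,S), one has max_{u, u' ∈ B(0,S')} f(u)/f(u') ≤ 1 + C/M. The same bound (with a possibly different constant) holds for every positive function f on the cylinder 𝒞(x,S) in 𝒢_n(a) (with S < n/2) that is discrete-harmonic there: max_{u,u' ∈ B(x,S')} f(u)/f(u') ≤ 1 + C/M. -/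
attribute [local instance] Classical.propDecidable

noncomputable section

namespace Harnack

/-- The six unit steps of simple random walk on `ℤ³`. -/
def step3 : Fin 6 → ℤ × ℤ × ℤ :=
  ![(1, 0, 0), (-1, 0, 0), (0, 1, 0), (0, -1, 0), (0, 0, 1), (0, 0, -1)]

/-- The (open) discrete Euclidean ball `B(c,S) = {y ∈ ℤ³ : |y - c| < S}`. -/
def ball3 (c : ℤ × ℤ × ℤ) (S : ℝ) : Set (ℤ × ℤ × ℤ) :=
  {y | (((y.1 - c.1) ^ 2 + (y.2.1 - c.2.1) ^ 2 + (y.2.2 - c.2.2) ^ 2 : ℤ) : ℝ) < S ^ 2}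

/-- `f` is discrete-harmonic at `y ∈ ℤ³`: `f(y)` is the average of `f` over the six
nearest neighbors of `y`. -/
def HarmonicAt3 (f : ℤ × ℤ × ℤ → ℝ) (y : ℤ × ℤ × ℤ) : Prop :=
  f y = (1 / 6) * ∑ e : Fin 6, f (y + step3 e)

/-- Side length, made positive so that `ZMod` is finite. -/
def side (m : ℕ) : ℕ := max m 1

instance (m : ℕ) : NeZero (side m) := ⟨by unfold side; omega⟩

/-- Vertex set of the thin torus `ℤ_n² × ℤ_h`. -/
abbrev TorusV (n h : ℕ) : Type := ZMod (side n) × ZMod (side n) × ZMod (side h)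

/-- The six nearest-neighbor steps in the torus. -/
def torusStep (n h : ℕ) : Fin 6 → TorusV n h :=
  ![(1, 0, 0), (-1, 0, 0), (0, 1, 0), (0, -1, 0), (0, 0, 1), (0, 0, -1)]

/-- Distance on the discrete circle `ℤ_m`. -/
def circDist {m : ℕ} (c : ZMod (side m)) : ℕ := min c.val (side m - c.val)

/-- The cylinder `𝒞(x,S)` in the thin torus: all vertices whose 2D projection lies within
(torus Euclidean) distance `S` of the 2D projection of `x`, at any height. -/
def cylinder {n h : ℕ} (x : TorusV n h) (S : ℝ) : Set (TorusV n h) :=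
  {y | ((circDist (y.1 - x.1) : ℝ)) ^ 2 + ((circDist (y.2.1 - x.2.1) : ℝ)) ^ 2 < S ^ 2}

/-- The discrete ball `B(x,S')` in the thin torus (torus Euclidean distance). -/
def torusBall {n h : ℕ} (x : TorusV n h) (S : ℝ) : Set (TorusV n h) :=
  {y | ((circDist (y.1 - x.1) : ℝ)) ^ 2 + ((circDist (y.2.1 - x.2.1) : ℝ)) ^ 2 +
        ((circDist (y.2.2 - x.2.2) : ℝ)) ^ 2 < S ^ 2}

/-- `f` is discrete-harmonic at a vertex `y` of the thin torus: `f(y)` is the average of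
`f` over the six nearest neighbors of `y`. -/
def HarmonicAtT {n h : ℕ} (f : TorusV n h → ℝ) (y : TorusV n h) : Prop :=
  f y = (1 / 6) * ∑ e : Fin 6, f (y + torusStep n h e)

/-- Height of the thin torus `𝒢_n(a)`. -/
def ht (a : ℝ) (n : ℕ) : ℕ := ⌊a * Real.log n⌋₊

/-- The index of the step opposite to a given one. -/
def opp : Fin 6 → Fin 6 := ![1, 0, 3, 2, 5, 4]

lemma step3_opp (e : Fin 6) : step3 (opp e) = -step3 e := by
  fin_cases e <;> rfl

/-- The squared Euclidean norm on `ℤ³`. -/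
def normSq (y : ℤ × ℤ × ℤ) : ℝ := (y.1 : ℝ) ^ 2 + (y.2.1 : ℝ) ^ 2 + (y.2.2 : ℝ) ^ 2

lemma mem_ball3_zero {y : ℤ × ℤ × ℤ} {S : ℝ} : y ∈ ball3 0 S ↔ normSq y < S ^ 2 := by
  simp [ball3, normSq]

lemma normSq_nonneg (y : ℤ × ℤ × ℤ) : 0 ≤ normSq y := by
  unfold normSq; positivity

lemma sum_normSq_add_step3_sub (y : ℤ × ℤ × ℤ) :
    ∑ e, (normSq (y + step3 e) - normSq y) = 6 := by
  simp [Fin.sum_univ_six, normSq, step3]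
  ring

lemma abs_normSq_add_step3_sub_le {y : ℤ × ℤ × ℤ} {S : ℝ} (hS : 1 ≤ S)
    (hy : normSq y < S ^ 2) (e : Fin 6) : |normSq (y + step3 e) - normSq y| ≤ 3 * S := by
  unfold normSq at hy
  have h1 : |(y.1 : ℝ)| ≤ S := abs_le_of_sq_le_sq (by nlinarith) (by linarith)
  have h2 : |(y.2.1 : ℝ)| ≤ S := abs_le_of_sq_le_sq (by nlinarith) (by linarith)
  have h3 : |(y.2.2 : ℝ)| ≤ S := abs_le_of_sq_le_sq (by nlinarith) (by linarith)
  rw [abs_le] at h1 h2 h3 ⊢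
  fin_cases e <;> simp [normSq, step3] <;> constructor <;> nlinarith

lemma finite_ball3 (S : ℝ) : (ball3 0 S).Finite := by
  have : ball3 0 S ⊆ (Set.Icc (-⌈|S|⌉) ⌈|S|⌉) ×ˢ (Set.Icc (-⌈|S|⌉) ⌈|S|⌉) ×ˢ
      (Set.Icc (-⌈|S|⌉) ⌈|S|⌉) := by
    intro y hy
    rw [mem_ball3_zero, normSq] at hy
    have key : ∀ k : ℤ, (k : ℝ) ^ 2 ≤ S ^ 2 → k ∈ Set.Icc (-⌈|S|⌉) ⌈|S|⌉ := by
      intro k hk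
      have h : |(k : ℝ)| ≤ ⌈|S|⌉ := (sq_le_sq.mp hk).trans (Int.le_ceil _)
      rw [Set.mem_Icc, ← abs_le]
      exact_mod_cast h
    exact ⟨key _ (by nlinarith), key _ (by nlinarith), key _ (by nlinarith)⟩
  exact ((Set.finite_Icc _ _).prod ((Set.finite_Icc _ _).prod (Set.finite_Icc _ _))).subset this

/-- A Cauchy–Schwarz inequality with an explicit remainder. -/
lemma sq_div_sub_div_le (a b : Fin 6 → ℝ) {g h : ℝ} (hg : 0 < g) (hh : 0 < h)
    (ha : ∑ e, a e ^ 2 = 6 * g ^ 2) (hb : ∑ e, b e ^ 2 = 6 * h ^ 2) (j : Fin 6) :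
    g * h / 2 * (a j / g - b j / h) ^ 2 ≤ 6 * g * h - ∑ e, a e * b e := by
  have h1 : ∑ e, g * h / 2 * (a e / g - b e / h) ^ 2 = 6 * g * h - ∑ e, a e * b e := by
    have : ∀ e, g * h / 2 * (a e / g - b e / h) ^ 2 =
        h / (2 * g) * a e ^ 2 + g / (2 * h) * b e ^ 2 - a e * b e := by
      intro e
      field_simp
      ring
    simp_rw [this]
    rw [Finset.sum_sub_distrib, Finset.sum_add_distrib, ← Finset.mul_sum, ← Finset.mul_sum, ha, hb]
    field_simp
    ring
  rw [← h1]
  exact Finset.single_le_sum (f := fun e => g * h / 2 * (a e / g - b e / h) ^ 2)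
    (fun e _ => by positivity) (Finset.mem_univ j)

lemma sq_max_two_sub_le {s t : ℝ} (hs : 0 < s) (ht : 0 < t) :
    (max (2 - s - t) 0) ^ 2 / 4 ≤ 1 / 2 * (s * (t - 1 / s) ^ 2) + 1 / 2 * (t * (s - 1 / t) ^ 2) := by
  rcases le_total (2 - s - t) 0 with h | h
  · rw [max_eq_right h]
    have : 0 ≤ 1 / 2 * (s * (t - 1 / s) ^ 2) + 1 / 2 * (t * (s - 1 / t) ^ 2) := by positivity
    simpa using this
  · rw [max_eq_left h]
    have hst : s * t ≤ ((s + t) / 2) ^ 2 := by nlinarith [sq_nonneg (s - t)]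
    have hm : (s + t) / 2 ≤ 1 := by linarith
    have h1 : (2 - s - t) / 2 ≤ 1 - s * t := by nlinarith
    have h2 : 2 ≤ 1 / s + 1 / t := by
      rw [div_add_div _ _ hs.ne' ht.ne', le_div_iff₀ (by positivity)]
      nlinarith
    have h3 : 1 / 2 * (s * (t - 1 / s) ^ 2) + 1 / 2 * (t * (s - 1 / t) ^ 2) =
        1 / 2 * (1 - s * t) ^ 2 * (1 / s + 1 / t) := by
      field_simp
      ring
    rw [h3]
    have h4 : ((2 - s - t) / 2) ^ 2 ≤ (1 - s * t) ^ 2 := by gcongr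
    nlinarith [sq_nonneg (1 - s * t)]

/-- The quantity `6 - ∑ₑ g(x+e)/g(x)`, which for `g = √f` with `f` harmonic at `x` measures the
squared logarithmic gradient of `f` at `x`. -/
def defect (g : ℤ × ℤ × ℤ → ℝ) (x : ℤ × ℤ × ℤ) : ℝ := 6 - ∑ e, g (x + step3 e) / g x

lemma sum_sq_div {g : ℤ × ℤ × ℤ → ℝ} {x : ℤ × ℤ × ℤ} (hx : 0 < g x)
    (h : ∑ e, g (x + step3 e) ^ 2 = 6 * g x ^ 2) :
    ∑ e, (g (x + step3 e) / g x) ^ 2 = 6 := by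
  simp_rw [div_pow]
  rw [← Finset.sum_div, h]
  field_simp

lemma sum_sq_div_sub_one {g : ℤ × ℤ × ℤ → ℝ} {x : ℤ × ℤ × ℤ} (hx : 0 < g x)
    (h : ∑ e, g (x + step3 e) ^ 2 = 6 * g x ^ 2) :
    ∑ e, (g (x + step3 e) / g x - 1) ^ 2 = 2 * defect g x := by
  have : ∀ e, (g (x + step3 e) / g x - 1) ^ 2 =
      (g (x + step3 e) / g x) ^ 2 - 2 * (g (x + step3 e) / g x) + 1 := fun e => by ring
  simp_rw [this]
  rw [Finset.sum_add_distrib, Finset.sum_sub_distrib, sum_sq_div hx h, ← Finset.mul_sum, defect]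
  simp
  ring

lemma defect_nonneg {g : ℤ × ℤ × ℤ → ℝ} {x : ℤ × ℤ × ℤ} (hx : 0 < g x)
    (h : ∑ e, g (x + step3 e) ^ 2 = 6 * g x ^ 2) : 0 ≤ defect g x := by
  have h1 := sum_sq_div_sub_one hx h
  have h2 : 0 ≤ ∑ e, (g (x + step3 e) / g x - 1) ^ 2 := Finset.sum_nonneg fun e _ => sq_nonneg _
  linarith

/-- A discrete Bochner inequality. -/
lemma sq_defect_le {g : ℤ × ℤ × ℤ → ℝ} {x : ℤ × ℤ × ℤ} (hx : 0 < g x)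
    (hpos : ∀ e, 0 < g (x + step3 e))
    (h : ∑ e, g (x + step3 e) ^ 2 = 6 * g x ^ 2)
    (h' : ∀ e, ∑ e', g (x + step3 e + step3 e') ^ 2 = 6 * g (x + step3 e) ^ 2) :
    defect g x ^ 2 / 12 ≤
      ∑ e, (g (x + step3 e) / g x) ^ 2 * (defect g (x + step3 e) - defect g x) := by
  set s : Fin 6 → ℝ := fun e => g (x + step3 e) / g x with hs
  have hspos : ∀ e, 0 < s e := fun e => div_pos (hpos e) hx
  have hterm : ∀ e, 1 / 2 * (s e * (s (opp e) - 1 / s e) ^ 2) ≤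
      6 * s e - (∑ e', g (x + step3 e') * g (x + step3 e + step3 e')) / g x ^ 2 := by
    intro e
    have h1 := sq_div_sub_div_le (fun e' => g (x + step3 e'))
      (fun e' => g (x + step3 e + step3 e')) hx (hpos e) h (h' e) (opp e)
    have h2 : x + step3 e + step3 (opp e) = x := by rw [step3_opp]; abel
    simp only [h2] at h1
    have h3 : 1 / 2 * (s e * (s (opp e) - 1 / s e) ^ 2) = g x * g (x + step3 e) / 2 *
        (g (x + step3 (opp e)) / g x - g x / g (x + step3 e)) ^ 2 / g x ^ 2 := by
      have := hpos e
      simp only [hs]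
      field_simp
    have h4 : 6 * s e = 6 * g x * g (x + step3 e) / g x ^ 2 := by
      simp only [hs]
      field_simp
    rw [h3, h4, ← sub_div]
    gcongr
  have hcomm : ∑ e, (∑ e', g (x + step3 e') * g (x + step3 e + step3 e')) / g x ^ 2 =
      ∑ e, s e ^ 2 * (6 - defect g (x + step3 e)) := by
    simp_rw [Finset.sum_div]
    rw [Finset.sum_comm]
    refine Finset.sum_congr rfl fun e _ => ?_
    rw [defect, sub_sub_cancel, Finset.mul_sum]
    refine Finset.sum_congr rfl fun e' _ => ?_
    rw [add_right_comm]
    have := hpos e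
    simp only [hs]
    field_simp
  have hsum : ∑ e, s e ^ 2 * (defect g (x + step3 e) - defect g x) =
      ∑ e, (6 * s e - (∑ e', g (x + step3 e') * g (x + step3 e + step3 e')) / g x ^ 2) := by
    have hs2 : ∑ e, s e ^ 2 = 6 := sum_sq_div hx h
    have hd : ∑ e, s e = 6 - defect g x := by rw [defect]; ring
    rw [Finset.sum_sub_distrib, hcomm, ← Finset.mul_sum, hd]
    simp_rw [mul_sub]
    rw [Finset.sum_sub_distrib, Finset.sum_sub_distrib, ← Finset.sum_mul, ← Finset.sum_mul, hs2]
    ring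
  rw [hsum]
  refine le_trans ?_ (Finset.sum_le_sum fun e _ => hterm e)
  have hq := defect_nonneg hx h
  have hd : defect g x = 6 - ∑ e, s e := rfl
  rw [Fin.sum_univ_six] at hd ⊢
  have p1 := sq_max_two_sub_le (hspos 0) (hspos 1)
  have p2 := sq_max_two_sub_le (hspos 2) (hspos 3)
  have p3 := sq_max_two_sub_le (hspos 4) (hspos 5)
  have m1 := le_max_left (2 - s 0 - s 1) 0
  have m2 := le_max_left (2 - s 2 - s 3) 0
  have m3 := le_max_left (2 - s 4 - s 5) 0
  set a := max (2 - s 0 - s 1) 0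
  set b := max (2 - s 2 - s 3) 0
  set c := max (2 - s 4 - s 5) 0
  have h1 : defect g x ^ 2 ≤ (a + b + c) ^ 2 := by
    have : defect g x ≤ a + b + c := by linarith
    gcongr
  have h2 : (a + b + c) ^ 2 ≤ 3 * (a ^ 2 + b ^ 2 + c ^ 2) := by
    nlinarith [sq_nonneg (a - b), sq_nonneg (b - c), sq_nonneg (a - c)]
  simp only [opp, Matrix.cons_val]
  linarith

lemma sq_mul_inv_sq_sub_one_le {s t : ℝ} (hs0 : 0 ≤ s) (hs : s ^ 2 ≤ 6) (ht : |t| ≤ 1 / 2) :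
    s ^ 2 * (1 / (1 - t) ^ 2 - 1) ≤ 2 * t + 49 / 4000 * (s - 1) ^ 2 + 1096 * t ^ 2 := by
  obtain ⟨ht1, ht2⟩ := abs_le.mp ht
  have h1 : 1 / (1 - t) ^ 2 - 1 ≤ 2 * t + 16 * t ^ 2 := by
    rw [tsub_le_iff_right, div_le_iff₀ (by nlinarith)]
    have : (2 * t + 16 * t ^ 2 + 1) * (1 - t) ^ 2 - 1 = t ^ 2 * (16 * (1 - t) ^ 2 - 3 + 2 * t) := by
      ring
    nlinarith [mul_nonneg (sq_nonneg t) (show 0 ≤ 16 * (1 - t) ^ 2 - 3 + 2 * t by nlinarith)]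
  have h2 : (s ^ 2 - 1) * (2 * t) ≤ (s ^ 2 - 1) ^ 2 / 1000 + 1000 * t ^ 2 := by
    nlinarith [sq_nonneg ((s ^ 2 - 1) - 1000 * t)]
  have h3 : (s ^ 2 - 1) ^ 2 ≤ 49 / 4 * (s - 1) ^ 2 := by
    have hs' : s ≤ 5 / 2 := by nlinarith
    have : (s + 1) ^ 2 ≤ 49 / 4 := by nlinarith
    nlinarith [mul_le_mul_of_nonneg_left this (sq_nonneg (s - 1))]
  have h4 : s ^ 2 * (1 / (1 - t) ^ 2 - 1) ≤ s ^ 2 * (2 * t + 16 * t ^ 2) := by gcongr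
  nlinarith [mul_le_mul_of_nonneg_right hs (sq_nonneg t)]

lemma normSq_lt_sq_of_lt {x : ℤ × ℤ × ℤ} {S : ℝ} (hS : 1 ≤ S) (hx : 3 * S < S ^ 2 - normSq x)
    (e : Fin 6) : normSq (x + step3 e) < S ^ 2 := by
  have := abs_le.mp (abs_normSq_add_step3_sub_le (y := x) hS (by linarith) e)
  linarith

/-- A gradient estimate for positive discrete-harmonic functions `f = g²` on a ball. -/
lemma sq_mul_defect_le {S : ℝ} (hS : 1 ≤ S) {g : ℤ × ℤ × ℤ → ℝ} (hg : ∀ y, 0 ≤ g y)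
    (hpos : ∀ y ∈ ball3 0 S, 0 < g y)
    (hharm : ∀ y ∈ ball3 0 S, (∀ e, y + step3 e ∈ ball3 0 S) →
      ∑ e, g (y + step3 e) ^ 2 = 6 * g y ^ 2) :
    ∀ x ∈ ball3 0 S, (S ^ 2 - normSq x) ^ 2 * defect g x ≤ 2000000 * S ^ 2 := by
  have hle : ∀ y, defect g y ≤ 6 := fun y =>
    sub_le_self _ (Finset.sum_nonneg fun e _ => div_nonneg (hg _) (hg _))
  obtain ⟨x, hx, hmax⟩ := Set.exists_max_image (ball3 0 S)
    (fun x => (S ^ 2 - normSq x) ^ 2 * defect g x) (finite_ball3 S)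
    ⟨0, by rw [mem_ball3_zero]; simp [normSq]; positivity⟩
  intro z hz
  refine (hmax z hz).trans ?_
  rw [mem_ball3_zero] at hx
  simp only [mem_ball3_zero] at hmax hpos hharm
  set p := S ^ 2 - normSq x with hp
  have hp0 : 0 < p := by linarith
  have hpS : p ≤ S ^ 2 := by linarith [normSq_nonneg x]
  rcases le_or_gt p (24 * S) with hcase | hcase
  · calc p ^ 2 * defect g x ≤ p ^ 2 * 6 := by gcongr; exact hle x
      _ ≤ (24 * S) ^ 2 * 6 := by gcongr
      _ ≤ 2000000 * S ^ 2 := by nlinarith [sq_nonneg S]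
  have hd : ∀ e, |normSq (x + step3 e) - normSq x| ≤ 3 * S :=
    abs_normSq_add_step3_sub_le hS hx
  have hx1 : ∀ e, normSq (x + step3 e) < S ^ 2 :=
    normSq_lt_sq_of_lt hS (by linarith)
  have hx2 : ∀ e e', normSq (x + step3 e + step3 e') < S ^ 2 := fun e =>
    normSq_lt_sq_of_lt hS (by linarith [(abs_le.mp (hd e)).2])
  have hgx := hpos x hx
  have hhx := hharm x hx hx1
  have hboch := sq_defect_le hgx (fun e => hpos _ (hx1 e)) hhx
    (fun e => hharm _ (hx1 e) (hx2 e))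
  have hsq := sum_sq_div hgx hhx
  have hsq1 := sum_sq_div_sub_one hgx hhx
  set q := defect g x with hq
  rcases le_or_gt q 0 with hq0 | hq0
  · have : p ^ 2 * q ≤ 0 := mul_nonpos_of_nonneg_of_nonpos (sq_nonneg p) hq0
    nlinarith [sq_nonneg S]
  have hterm : ∀ e, (g (x + step3 e) / g x) ^ 2 * (defect g (x + step3 e) - q) ≤
      q * (2 * ((normSq (x + step3 e) - normSq x) / p)
        + 49 / 4000 * (g (x + step3 e) / g x - 1) ^ 2 + 1096 * (9 * S ^ 2 / p ^ 2)) := by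
    intro e
    set s := g (x + step3 e) / g x with hs
    set d := normSq (x + step3 e) - normSq x with hd'
    have hs0 : 0 ≤ s := div_nonneg (hg _) (hg _)
    have hs6 : s ^ 2 ≤ 6 := by
      rw [← hsq]
      exact Finset.single_le_sum (f := fun e => (g (x + step3 e) / g x) ^ 2)
        (fun e _ => sq_nonneg _) (Finset.mem_univ e)
    have hde := hd e
    have ht : |d / p| ≤ 1 / 2 := by
      rw [abs_div, abs_of_pos hp0, div_le_iff₀ hp0]
      linarith
    have hpd : 0 < p - d := by linarith [(abs_le.mp hde).2]
    have hqe : defect g (x + step3 e) ≤ q * (1 / (1 - d / p) ^ 2) := by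
      have h1 := hmax (x + step3 e) (hx1 e)
      have h2 : S ^ 2 - normSq (x + step3 e) = p - d := by rw [hp, hd']; ring
      simp only [h2] at h1
      have h3 : q * (1 / (1 - d / p) ^ 2) = p ^ 2 * q / (p - d) ^ 2 := by
        field_simp
      rw [h3, le_div_iff₀ (by positivity)]
      linarith
    have ht2 : (d / p) ^ 2 ≤ 9 * S ^ 2 / p ^ 2 := by
      rw [div_pow, ← sq_abs d]
      gcongr
      nlinarith [abs_nonneg d]
    calc s ^ 2 * (defect g (x + step3 e) - q)
        ≤ s ^ 2 * (q * (1 / (1 - d / p) ^ 2) - q) := by gcongr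
      _ = q * (s ^ 2 * (1 / (1 - d / p) ^ 2 - 1)) := by ring
      _ ≤ q * (2 * (d / p) + 49 / 4000 * (s - 1) ^ 2 + 1096 * (d / p) ^ 2) := by
        gcongr
        exact sq_mul_inv_sq_sub_one_le hs0 hs6 ht
      _ ≤ _ := by gcongr
  have hsum := hboch.trans (Finset.sum_le_sum fun e _ => hterm e)
  rw [← Finset.mul_sum, Finset.sum_add_distrib, Finset.sum_add_distrib, ← Finset.mul_sum,
    ← Finset.mul_sum, ← Finset.sum_div, sum_normSq_add_step3_sub, hsq1] at hsum
  simp only [Finset.sum_const, Finset.card_univ, Fintype.card_fin, nsmul_eq_mul] at hsum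
  push_cast at hsum
  have h1 : q / 12 ≤ 2 * (6 / p) + 49 / 4000 * (2 * q) + 6 * (1096 * (9 * S ^ 2 / p ^ 2)) := by
    refine le_of_mul_le_mul_left ?_ hq0
    linarith
  have h2 : q / 24 ≤ 12 / p + 59184 * S ^ 2 / p ^ 2 := by
    have : 12 / p + 59184 * S ^ 2 / p ^ 2 = 2 * (6 / p) + 6 * (1096 * (9 * S ^ 2 / p ^ 2)) := by
      ring
    linarith
  have h3 : p ^ 2 * (q / 24) ≤ 12 * p + 59184 * S ^ 2 := by
    calc p ^ 2 * (q / 24) ≤ p ^ 2 * (12 / p + 59184 * S ^ 2 / p ^ 2) := by gcongr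
      _ = _ := by field_simp
  nlinarith

lemma le_exp_mul_of_harmonic {S : ℝ} (hS : 2 ≤ S) {f : ℤ × ℤ × ℤ → ℝ}
    (hpos : ∀ y ∈ ball3 0 S, 0 < f y)
    (hharm : ∀ y ∈ ball3 0 S, (∀ e : Fin 6, y + step3 e ∈ ball3 0 S) → HarmonicAt3 f y)
    {x : ℤ × ℤ × ℤ} (hx : normSq x < (S / 2) ^ 2) (e : Fin 6) :
    f (x + step3 e) ≤ Real.exp (6000 / S) * f x := by
  have hS0 : 0 < S := by linarith
  have hxS : x ∈ ball3 0 S := by rw [mem_ball3_zero]; nlinarith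
  have hxe : ∀ e, x + step3 e ∈ ball3 0 S := by
    intro e
    rw [mem_ball3_zero]
    have := (abs_le.mp (abs_normSq_add_step3_sub_le (by linarith) hx e)).2
    nlinarith
  have hsq : ∀ y ∈ ball3 0 S, √(f y) ^ 2 = f y := fun y hy => Real.sq_sqrt (hpos y hy).le
  have hh : ∀ y ∈ ball3 0 S, (∀ e, y + step3 e ∈ ball3 0 S) →
      ∑ e, √(f (y + step3 e)) ^ 2 = 6 * √(f y) ^ 2 := by
    intro y hy hye
    have := hharm y hy hye
    rw [HarmonicAt3] at this
    rw [hsq y hy, Finset.sum_congr rfl fun e _ => hsq _ (hye e)]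
    linarith
  have hgpos : ∀ y ∈ ball3 0 S, 0 < √(f y) := fun y hy => Real.sqrt_pos.mpr (hpos y hy)
  have hq := sq_mul_defect_le (g := fun y => √(f y)) (by linarith) (fun y => Real.sqrt_nonneg _)
    hgpos hh x hxS
  have hsum := sum_sq_div_sub_one (g := fun y => √(f y)) (hgpos x hxS) (hh x hxS hxe)
  have hq0 := defect_nonneg (g := fun y => √(f y)) (hgpos x hxS) (hh x hxS hxe)
  set q := defect (fun y => √(f y)) x
  have hs1 : (√(f (x + step3 e)) / √(f x) - 1) ^ 2 ≤ 2 * q := by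
    rw [← hsum]
    exact Finset.single_le_sum (f := fun e => (√(f (x + step3 e)) / √(f x) - 1) ^ 2)
      (fun e _ => sq_nonneg _) (Finset.mem_univ e)
  set s := √(f (x + step3 e)) / √(f x) with hs
  have hs0 : 0 ≤ s := by positivity
  have hp : (3 / 4 * S ^ 2) ^ 2 * q ≤ 2000000 * S ^ 2 := by
    refine le_trans ?_ hq
    gcongr
    linarith
  have hqS : S ^ 2 * q ≤ 4000000 := by
    have hS2 : 0 < S ^ 2 := by positivity
    refine le_of_mul_le_mul_left ?_ hS2
    nlinarith [mul_nonneg hS2.le hq0]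
  have hs2 : s - 1 ≤ 3000 / S := by
    rw [le_div_iff₀ hS0]
    refine abs_le_of_sq_le_sq' (b := 3000) ?_ (by norm_num) |>.2
    nlinarith [mul_le_mul_of_nonneg_left hs1 (sq_nonneg S)]
  have hs3 : s ^ 2 ≤ Real.exp (6000 / S) := by
    calc s ^ 2 ≤ Real.exp (3000 / S) ^ 2 := by
          gcongr
          linarith [Real.add_one_le_exp (3000 / S)]
      _ = Real.exp (6000 / S) := by
          rw [← Real.exp_nat_mul]
          congr 1
          push_cast
          ring
  have hf : f (x + step3 e) = s ^ 2 * f x := by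
    rw [hs, div_pow, hsq _ hxS, hsq _ (hxe e), div_mul_cancel₀ _ (hpos x hxS).ne']
  rw [hf]
  have := hpos x hxS
  gcongr

/-- The `ℓ¹` norm on `ℤ³`. -/
def l1Norm (y : ℤ × ℤ × ℤ) : ℕ := y.1.natAbs + y.2.1.natAbs + y.2.2.natAbs

lemma exists_step3_l1Norm_add_one {u : ℤ × ℤ × ℤ} (hu : l1Norm u ≠ 0) :
    ∃ e, l1Norm (u + step3 e) + 1 = l1Norm u ∧ normSq (u + step3 e) ≤ normSq u := by
  obtain ⟨a, b, c⟩ := u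
  have key : ∀ k : ℤ, 0 < k → ((k : ℝ) + -1) ^ 2 ≤ (k : ℝ) ^ 2 := by
    intro k hk
    have : (1 : ℝ) ≤ k := by exact_mod_cast hk
    nlinarith
  have key' : ∀ k : ℤ, k < 0 → ((k : ℝ) + 1) ^ 2 ≤ (k : ℝ) ^ 2 := by
    intro k hk
    have : (k : ℝ) ≤ -1 := by exact_mod_cast (by omega : k ≤ -1)
    nlinarith
  simp only [l1Norm] at hu
  rcases lt_trichotomy a 0 with h | h | h
  · exact ⟨0, by simp [l1Norm, step3]; omega, by simpa [normSq, step3] using key' a h⟩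
  · rcases lt_trichotomy b 0 with h | h | h
    · exact ⟨2, by simp [l1Norm, step3]; omega, by simpa [normSq, step3] using key' b h⟩
    · rcases lt_trichotomy c 0 with h | h | h
      · exact ⟨4, by simp [l1Norm, step3]; omega, by simpa [normSq, step3] using key' c h⟩
      · omega
      · exact ⟨5, by simp [l1Norm, step3]; omega, by simpa [normSq, step3] using key c h⟩
    · exact ⟨3, by simp [l1Norm, step3]; omega, by simpa [normSq, step3] using key b h⟩
  · exact ⟨1, by simp [l1Norm, step3]; omega, by simpa [normSq, step3] using key a h⟩

lemma l1Norm_le {u : ℤ × ℤ × ℤ} {r : ℝ} (hr : 0 ≤ r) (hu : normSq u < r ^ 2) :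
    (l1Norm u : ℝ) ≤ 3 * r := by
  unfold normSq at hu
  have h1 : |(u.1 : ℝ)| ≤ r := abs_le_of_sq_le_sq (by nlinarith) hr
  have h2 : |(u.2.1 : ℝ)| ≤ r := abs_le_of_sq_le_sq (by nlinarith) hr
  have h3 : |(u.2.2 : ℝ)| ≤ r := abs_le_of_sq_le_sq (by nlinarith) hr
  simp only [l1Norm, Nat.cast_add, Nat.cast_natAbs, Int.cast_abs]
  linarith

/-- A function on `ℤ³` that grows by a factor at most `exp c` at each step out of a ball around
the origin is comparable to its value at the origin. -/
lemma le_exp_l1Norm_mul {f : ℤ × ℤ × ℤ → ℝ} {c r : ℝ}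
    (h : ∀ x, normSq x < r → ∀ e, f (x + step3 e) ≤ Real.exp c * f x) (k : ℕ) :
    ∀ u, l1Norm u = k → normSq u < r →
      f u ≤ Real.exp (k * c) * f 0 ∧ f 0 ≤ Real.exp (k * c) * f u := by
  induction k with
  | zero =>
    intro u hu _
    have : u = 0 := by
      simp only [l1Norm] at hu
      ext <;> simp <;> omega
    simp [this]
  | succ k ih =>
    intro u hu hur
    obtain ⟨e, he, her⟩ := exists_step3_l1Norm_add_one (u := u) (by omega)
    obtain ⟨i1, i2⟩ := ih (u + step3 e) (by omega) (her.trans_lt hur)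
    have h1 := h u hur e
    have h2 := h (u + step3 e) (her.trans_lt hur) (opp e)
    rw [step3_opp, add_neg_cancel_right] at h2
    have hexp : Real.exp ((k + 1 : ℕ) * c) = Real.exp c * Real.exp (k * c) := by
      rw [← Real.exp_add]
      congr 1
      push_cast
      ring
    rw [hexp]
    constructor
    · calc f u ≤ _ := h2
        _ ≤ Real.exp c * (Real.exp (k * c) * f 0) := by gcongr
        _ = _ := by ring
    · calc f 0 ≤ _ := i2
        _ ≤ Real.exp (k * c) * (Real.exp c * f u) := by gcongr
        _ = _ := by ring

lemma exp_div_le {t : ℝ} {M : ℝ} (hM : 1 ≤ M) : Real.exp (t / M) ≤ 1 + Real.exp t / M := by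
  have h0 : 0 < M := by linarith
  have hinv : 1 / M ≤ 1 := (div_le_one h0).mpr hM
  have h := convexOn_exp.2 (Set.mem_univ 0) (Set.mem_univ t) (sub_nonneg.mpr hinv)
    (by positivity : 0 ≤ 1 / M) (by ring)
  simp only [smul_eq_mul, mul_zero, zero_add, Real.exp_zero, mul_one] at h
  rw [one_div_mul_eq_div, one_div_mul_eq_div] at h
  have : 0 < 1 / M := by positivity
  linarith

/-- The Harnack oscillation bound on balls of `ℤ³`, with an explicit constant. -/
theorem harnack_ball3 {M : ℕ} (hM : 2 ≤ M) {S' S : ℝ} (hS' : 1 ≤ S') (hS : S = (M : ℝ) * S')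
    {f : ℤ × ℤ × ℤ → ℝ} (hpos : ∀ y ∈ ball3 0 S, 0 < f y)
    (hharm : ∀ y ∈ ball3 0 S, (∀ e : Fin 6, y + step3 e ∈ ball3 0 S) → HarmonicAt3 f y)
    {u u' : ℤ × ℤ × ℤ} (hu : u ∈ ball3 0 S') (hu' : u' ∈ ball3 0 S') :
    f u / f u' ≤ 1 + Real.exp 36000 / (M : ℝ) := by
  have hM2 : (2 : ℝ) ≤ M := by exact_mod_cast hM
  have hSS : S' ≤ S / 2 := by nlinarith
  have hS2 : 2 ≤ S := by linarith
  have hball : ∀ {v}, v ∈ ball3 0 S' → normSq v < (S / 2) ^ 2 ∧ v ∈ ball3 0 S ∧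
      l1Norm v * (6000 / S) ≤ 18000 / M := by
    intro v hv
    rw [mem_ball3_zero] at hv ⊢
    refine ⟨by nlinarith, by nlinarith, ?_⟩
    have h1 := l1Norm_le (by linarith) hv
    calc l1Norm v * (6000 / S) ≤ 3 * S' * (6000 / S) := by gcongr
      _ = 18000 / M := by
        rw [hS]
        field_simp
        norm_num
  have hstep := fun x hx e => le_exp_mul_of_harmonic (x := x) hS2 hpos hharm hx e
  obtain ⟨a1, a2, a3⟩ := hball hu
  obtain ⟨b1, b2, b3⟩ := hball hu'
  have ha := (le_exp_l1Norm_mul hstep _ u rfl a1).1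
  have hb := (le_exp_l1Norm_mul hstep _ u' rfl b1).2
  have h0 : 0 < f 0 := hpos 0 (by rw [mem_ball3_zero]; simp [normSq]; positivity)
  have hfu' := hpos u' b2
  rw [div_le_iff₀ hfu']
  calc f u ≤ Real.exp (18000 / M) * f 0 := ha.trans (by gcongr)
    _ ≤ Real.exp (18000 / M) * (Real.exp (18000 / M) * f u') := by
      gcongr
      exact hb.trans (by gcongr)
    _ = Real.exp (36000 / M) * f u' := by
      rw [← mul_assoc, ← Real.exp_add]
      congr 2
      ring
    _ ≤ _ := by
      gcongr
      exact exp_div_le (by linarith)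

lemma circDist_intCast_le {m : ℕ} (k : ℤ) :
    circDist (m := m) (k : ZMod (side m)) ≤ k.natAbs := by
  have hm : 0 < side m := Nat.pos_of_neZero _
  have h := ZMod.val_intCast (n := side m) k
  have h1 := Int.emod_nonneg k (by omega : (side m : ℤ) ≠ 0)
  have h2 := Int.emod_lt_of_pos k (by omega : (0 : ℤ) < side m)
  have h3 := Int.mul_ediv_add_emod k (side m)
  unfold circDist
  rcases le_or_gt 0 k with hk | hk
  · have h4 : 0 ≤ k / (side m : ℤ) := Int.ediv_nonneg hk (by omega)
    have h5 : 0 ≤ (side m : ℤ) * (k / (side m : ℤ)) := by positivity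
    omega
  · have h4 : k / (side m : ℤ) ≤ -1 := by
      have := Int.ediv_neg_of_neg_of_pos hk (by omega : (0 : ℤ) < side m)
      omega
    have h5 : (side m : ℤ) * (k / (side m : ℤ)) ≤ side m * (-1) := by gcongr
    omega

lemma exists_intCast_eq_natAbs_eq_circDist {m : ℕ} (c : ZMod (side m)) :
    ∃ k : ℤ, (k : ZMod (side m)) = c ∧ k.natAbs = circDist c := by
  have hlt := ZMod.val_lt c
  unfold circDist
  rcases le_total c.val (side m - c.val) with h | h
  · refine ⟨c.val, by simp, ?_⟩
    rw [min_eq_left h]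
    omega
  · refine ⟨(c.val : ℤ) - side m, by simp, ?_⟩
    rw [min_eq_right h]
    omega

/-- The covering map `ℤ³ → ℤ_n² × ℤ_h` sending the origin to `x`. -/
def cover {n h : ℕ} (x : TorusV n h) (y : ℤ × ℤ × ℤ) : TorusV n h :=
  x + ((y.1 : ZMod (side n)), (y.2.1 : ZMod (side n)), (y.2.2 : ZMod (side h)))

lemma cover_add_step3 {n h : ℕ} (x : TorusV n h) (y : ℤ × ℤ × ℤ) (e : Fin 6) :
    cover x (y + step3 e) = cover x y + torusStep n h e := by
  unfold cover
  rw [add_assoc]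
  congr 1
  fin_cases e <;> simp [step3, torusStep]

lemma sq_natAbs_cast (k : ℤ) : ((k.natAbs : ℕ) : ℝ) ^ 2 = (k : ℝ) ^ 2 := by
  rw [Nat.cast_natAbs, Int.cast_abs, sq_abs]

lemma sq_circDist_intCast_le {m : ℕ} (k : ℤ) :
    (circDist (m := m) (k : ZMod (side m)) : ℝ) ^ 2 ≤ (k : ℝ) ^ 2 := by
  rw [← sq_natAbs_cast]
  gcongr
  exact circDist_intCast_le k

lemma cover_mem_cylinder {n h : ℕ} (x : TorusV n h) {S : ℝ} {y : ℤ × ℤ × ℤ}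
    (hy : y ∈ ball3 0 S) : cover x y ∈ cylinder x S := by
  rw [mem_ball3_zero, normSq] at hy
  have h1 := sq_circDist_intCast_le (m := n) y.1
  have h2 := sq_circDist_intCast_le (m := n) y.2.1
  simp only [cylinder, cover, Set.mem_ofPred_eq, Prod.fst_add, Prod.snd_add, add_sub_cancel_left]
  nlinarith [sq_nonneg (y.2.2 : ℝ)]

lemma exists_cover_eq {n h : ℕ} {x u : TorusV n h} {S : ℝ} (hu : u ∈ torusBall x S) :
    ∃ y ∈ ball3 0 S, cover x y = u := by
  obtain ⟨a, ha, ha'⟩ := exists_intCast_eq_natAbs_eq_circDist (u.1 - x.1)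
  obtain ⟨b, hb, hb'⟩ := exists_intCast_eq_natAbs_eq_circDist (u.2.1 - x.2.1)
  obtain ⟨c, hc, hc'⟩ := exists_intCast_eq_natAbs_eq_circDist (u.2.2 - x.2.2)
  refine ⟨(a, b, c), ?_, ?_⟩
  · rw [mem_ball3_zero, normSq]
    simpa only [torusBall, Set.mem_ofPred_eq, ← ha', ← hb', ← hc', sq_natAbs_cast] using hu
  · simp only [cover, ha, hb, hc]
    ext <;> simp

/-- Lemma 4.3 (Harnack-type oscillation bounds).  There is `C < ∞` such that for every
integer `M ≥ 2`, every `S' ≥ 1` and `S = M S'`, every positive discrete-harmonic function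
on `B(0,S) ⊂ ℤ³` satisfies `max_{u,u' ∈ B(0,S')} f(u)/f(u') ≤ 1 + C/M`; and similarly
(with a possibly different constant) for positive discrete-harmonic functions on
a cylinder `𝒞(x,S)` (with `S < n/2`) of the thin torus `𝒢_n(a)`. -/
theorem harnack_oscillation :
    (∃ C : ℝ, ∀ M : ℕ, 2 ≤ M → ∀ S' S : ℝ, 1 ≤ S' → S = (M : ℝ) * S' →
      ∀ f : ℤ × ℤ × ℤ → ℝ,
        (∀ y ∈ ball3 0 S, 0 < f y) →
        (∀ y ∈ ball3 0 S, (∀ e : Fin 6, y + step3 e ∈ ball3 0 S) → HarmonicAt3 f y) →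
        ∀ u ∈ ball3 0 S', ∀ u' ∈ ball3 0 S', f u / f u' ≤ 1 + C / (M : ℝ)) ∧
    (∃ C : ℝ, ∀ (n : ℕ) (a : ℝ), 0 < a → ∀ M : ℕ, 2 ≤ M → ∀ S' S : ℝ, 1 ≤ S' →
      S = (M : ℝ) * S' → S < (n : ℝ) / 2 →
      ∀ x : TorusV n (ht a n), ∀ f : TorusV n (ht a n) → ℝ,
        (∀ y ∈ cylinder x S, 0 < f y) →
        (∀ y ∈ cylinder x S, (∀ e : Fin 6, y + torusStep n (ht a n) e ∈ cylinder x S) →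
          HarmonicAtT f y) →
        ∀ u ∈ torusBall x S', ∀ u' ∈ torusBall x S',
          f u / f u' ≤ 1 + C / (M : ℝ)) := by
  refine ⟨⟨Real.exp 36000, ?_⟩, ⟨Real.exp 36000, ?_⟩⟩
  · intro M hM S' S hS' hS f hpos hharm u hu u' hu'
    exact harnack_ball3 hM hS' hS hpos hharm hu hu'
  · intro n a _ M hM S' S hS' hS _ x f hpos hharm u hu u' hu'
    obtain ⟨v, hv, rfl⟩ := exists_cover_eq hu
    obtain ⟨v', hv', rfl⟩ := exists_cover_eq hu'
    refine harnack_ball3 (f := fun y => f (cover x y)) hM hS' hS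
      (fun y hy => hpos _ (cover_mem_cylinder x hy)) (fun y hy hye => ?_) hv hv'
    have h := hharm (cover x y) (cover_mem_cylinder x hy)
      fun e => cover_add_step3 x y e ▸ cover_mem_cylinder x (hye e)
    simpa only [HarmonicAt3, HarmonicAtT, cover_add_step3] using h

end Harnack
end
end

section
/- Fix κ ∈ (0,∞) and real numbers z, w with w ≥ √κ · z > 0. Then lim_{p → 0⁺} I_{p, κp}(z, w) = inf_{v ≥ 0} ( v z² − v w²/(κ + v) ) = − (w − √κ z)². -/
open Filter
open scoped Topology

noncomputable section

/-- `Λ_{p,p'}(θ) = log(1 - p + p p'/(e^θ - 1 + p'))`, the log-Laplace transform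
`log E[exp(-θ J(1+Y))]` for `J` Bernoulli(`p`) independent of `Y` Geometric(`p'`). -/
def Lam (p p' θ : ℝ) : ℝ := Real.log (1 - p + p * p' / (Real.exp θ - 1 + p'))

/-- `I_{p,p'}(z,w) = (1/p) inf_{θ ≥ 0} { z² θ + w² Λ_{p,p'}(θ) }`. -/
def Ipp (p p' z w : ℝ) : ℝ :=
  (1 / p) * sInf ((fun θ : ℝ => z ^ 2 * θ + w ^ 2 * Lam p p' θ) '' Set.Ici (0:ℝ))

/-- The limiting rate function is bounded below by its value at its minimizer. -/
theorem neg_sq_le_limit_rate {r z w v : ℝ} (hr : 0 < r) (hv : 0 ≤ v) :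
    -(w - r * z) ^ 2 ≤ v * z ^ 2 - v * w ^ 2 / (r ^ 2 + v) := by
  have hpos : 0 < r ^ 2 + v := by positivity
  have key : v * z ^ 2 - v * w ^ 2 / (r ^ 2 + v) + (w - r * z) ^ 2
      = (v * z - r * (w - r * z)) ^ 2 / (r ^ 2 + v) := by
    field_simp
    ring
  have : 0 ≤ (v * z - r * (w - r * z)) ^ 2 / (r ^ 2 + v) := by positivity
  linarith

theorem limit_rate_minimizer {r z w : ℝ} (hr : 0 < r) (hz : 0 < z) (hw : r * z ≤ w) :
    r * (w - r * z) / z * z ^ 2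
      - r * (w - r * z) / z * w ^ 2 / (r ^ 2 + r * (w - r * z) / z) = -(w - r * z) ^ 2 := by
  have hw0 : 0 < w := (mul_pos hr hz).trans_le hw
  have : r ^ 2 + r * (w - r * z) / z = r * w / z := by
    field_simp
    ring
  rw [this]
  field_simp
  ring

theorem Lam_eq {p κ θ : ℝ} (hp : 0 < p) (hκ : 0 < κ) (hθ : 0 ≤ θ) :
    Lam p (κ * p) θ
      = Real.log (1 - p * ((Real.exp θ - 1) / (Real.exp θ - 1 + κ * p))) := by
  have h1 : 0 ≤ Real.exp θ - 1 := by linarith [Real.add_one_le_exp θ]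
  have h2 : 0 < Real.exp θ - 1 + κ * p := by positivity
  unfold Lam
  congr 1
  field_simp
  ring

/-- Lower bound on `Λ_{p,κp}(θ)` from `log (1 - s) ≥ -s / (1 - s)`. -/
theorem le_Lam {p κ θ : ℝ} (hp : 0 < p) (hp1 : p < 1) (hκ : 0 < κ) (hθ : 0 ≤ θ) :
    -(p * ((Real.exp θ - 1) / (Real.exp θ - 1 + κ * p)) / (1 - p)) ≤ Lam p (κ * p) θ := by
  have h1 : 0 ≤ Real.exp θ - 1 := by linarith [Real.add_one_le_exp θ]
  have h2 : 0 < Real.exp θ - 1 + κ * p := by positivity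
  rw [Lam_eq hp hκ hθ]
  set q := (Real.exp θ - 1) / (Real.exp θ - 1 + κ * p) with hq
  have hq0 : 0 ≤ q := by positivity
  have hq1 : q ≤ 1 := by
    rw [hq, div_le_one h2]
    linarith [mul_pos hκ hp]
  have hpq : p * q ≤ p := mul_le_of_le_one_right hp.le hq1
  have hs : 0 < 1 - p * q := by linarith
  have hlog := Real.one_sub_inv_le_log_of_pos hs
  have heq : 1 - (1 - p * q)⁻¹ = -(p * q / (1 - p * q)) := by
    field_simp
    ring
  have hle : p * q / (1 - p * q) ≤ p * q / (1 - p) :=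
    div_le_div_of_nonneg_left (by positivity) (by linarith) (by linarith)
  linarith

theorem exp_sub_one_le_mul_exp (θ : ℝ) : Real.exp θ - 1 ≤ θ * Real.exp θ := by
  have h := Real.add_one_le_exp (-θ)
  have h2 : Real.exp (-θ) * Real.exp θ = 1 := by rw [← Real.exp_add]; simp
  nlinarith [Real.exp_pos θ]

/-- The function minimized in `Ipp` is bounded below by the limit up to a uniform error. -/
theorem rate_lower_bound {r z w p θ : ℝ} (hr : 0 < r) (hz : 0 < z) (hp : 0 < p)
    (hp2 : p ≤ 1 / 2) (hθ : 0 ≤ θ) :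
    p * (-(w - r * z) ^ 2 - (Real.exp (p * (2 * w ^ 2 / z ^ 2)) / (1 - p) - 1) * w ^ 2)
      ≤ z ^ 2 * θ + w ^ 2 * Lam p (r ^ 2 * p) θ := by
  have hκ : 0 < r ^ 2 := by positivity
  have hp1 : 0 < 1 - p := by linarith
  have h1 : 0 ≤ Real.exp θ - 1 := by linarith [Real.add_one_le_exp θ]
  have h2 : 0 < Real.exp θ - 1 + r ^ 2 * p := by positivity
  have hL := mul_le_mul_of_nonneg_left (le_Lam hp (by linarith) hκ hθ) (sq_nonneg w)
  set q := (Real.exp θ - 1) / (Real.exp θ - 1 + r ^ 2 * p) with hq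
  set M := 2 * w ^ 2 / z ^ 2 with hM
  set E := Real.exp (p * M) with hE
  have hM0 : 0 ≤ M := by positivity
  have hE1 : 1 ≤ E := Real.one_le_exp (by positivity)
  have hC1 : 1 ≤ E / (1 - p) := by
    rw [le_div_iff₀ hp1]
    linarith
  have hzM : z ^ 2 * M = 2 * w ^ 2 := by
    rw [hM]
    field_simp
  rcases le_or_gt θ (p * M) with hle | hgt
  · set u := θ / p with hu
    have hu0 : 0 ≤ u := by positivity
    have hθu : θ = p * u := by rw [hu]; field_simp
    have hx : Real.exp θ - 1 ≤ θ * E :=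
      (exp_sub_one_le_mul_exp θ).trans
        (mul_le_mul_of_nonneg_left (Real.exp_le_exp.mpr hle) hθ)
    have hqu : q ≤ E * (u / (r ^ 2 + u)) := by
      have : E * (u / (r ^ 2 + u)) = E * θ / (θ + r ^ 2 * p) := by
        rw [hθu]
        field_simp
        ring
      rw [this, hq, div_le_div_iff₀ h2 (by positivity)]
      have e1 : (Real.exp θ - 1) * (r ^ 2 * p) ≤ θ * E * (r ^ 2 * p) :=
        mul_le_mul_of_nonneg_right hx (by positivity)
      have e2 : (Real.exp θ - 1) * θ ≤ E * ((Real.exp θ - 1) * θ) :=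
        le_mul_of_one_le_left (by positivity) hE1
      linarith
    have hu1 : u / (r ^ 2 + u) ≤ 1 := by
      rw [div_le_one (by positivity)]
      linarith
    have hg := neg_sq_le_limit_rate (z := z) (w := w) hr hu0
    have hqC : q / (1 - p) ≤ u / (r ^ 2 + u) + (E / (1 - p) - 1) := by
      have e1 : q / (1 - p) ≤ E / (1 - p) * (u / (r ^ 2 + u)) := by
        rw [div_mul_eq_mul_div]
        exact div_le_div_of_nonneg_right hqu hp1.le
      nlinarith
    have e3 := mul_le_mul_of_nonneg_left hqC (sq_nonneg w)
    have e4 : -(w - r * z) ^ 2 - (E / (1 - p) - 1) * w ^ 2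
        ≤ z ^ 2 * u - w ^ 2 * (q / (1 - p)) := by
      have : u * w ^ 2 / (r ^ 2 + u) = w ^ 2 * (u / (r ^ 2 + u)) := by ring
      linarith
    have e5 := mul_le_mul_of_nonneg_left e4 hp.le
    have e6 : p * (z ^ 2 * u - w ^ 2 * (q / (1 - p)))
        = z ^ 2 * θ + w ^ 2 * -(p * q / (1 - p)) := by
      rw [hθu]
      ring
    linarith
  · have hq1 : q ≤ 1 := by
      rw [hq, div_le_one h2]
      linarith [mul_pos hκ hp]
    have hqp : p * q / (1 - p) ≤ 2 * p := by
      rw [div_le_iff₀ hp1]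
      nlinarith
    have e1 := mul_le_mul_of_nonneg_left hqp (sq_nonneg w)
    have e2 := mul_le_mul_of_nonneg_left hgt.le (sq_nonneg z)
    have e3 : z ^ 2 * (p * M) = 2 * p * w ^ 2 := by linear_combination p * hzM
    have e4 : 0 ≤ p * ((w - r * z) ^ 2 + (E / (1 - p) - 1) * w ^ 2) := by
      have : 0 ≤ E / (1 - p) - 1 := by linarith
      positivity
    linarith

theorem Lam_log_one_add_le {p κ v : ℝ} (hp : 0 < p) (hp1 : p < 1) (hκ : 0 < κ) (hv : 0 ≤ v) :
    Lam p (κ * p) (Real.log (1 + p * v)) ≤ -(p * (v / (κ + v))) := by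
  have h1 : 0 < 1 + p * v := by positivity
  rw [Lam_eq hp hκ (Real.log_nonneg (by nlinarith)), Real.exp_log h1]
  have hq : (1 + p * v - 1) / (1 + p * v - 1 + κ * p) = v / (κ + v) := by
    have : 1 + p * v - 1 + κ * p = p * (κ + v) := by ring
    rw [this, add_sub_cancel_left, mul_div_mul_left _ _ hp.ne']
  rw [hq]
  have hq1 : v / (κ + v) ≤ 1 := by
    rw [div_le_one (by positivity)]
    linarith
  have hpos : 0 < 1 - p * (v / (κ + v)) := by nlinarith
  linarith [Real.log_le_sub_one_of_pos hpos]

theorem le_Ipp {r z w p : ℝ} (hr : 0 < r) (hz : 0 < z) (hp : 0 < p) (hp2 : p ≤ 1 / 2) :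
    -(w - r * z) ^ 2 - (Real.exp (p * (2 * w ^ 2 / z ^ 2)) / (1 - p) - 1) * w ^ 2
      ≤ Ipp p (r ^ 2 * p) z w := by
  unfold Ipp
  rw [one_div, inv_mul_eq_div, le_div_iff₀ hp, mul_comm]
  refine le_csInf (Set.nonempty_Ici.image _) ?_
  rintro _ ⟨θ, hθ, rfl⟩
  exact rate_lower_bound hr hz hp hp2 hθ

theorem Ipp_le {r z w p : ℝ} (hr : 0 < r) (hz : 0 < z) (hw : r * z ≤ w) (hp : 0 < p)
    (hp2 : p ≤ 1 / 2) : Ipp p (r ^ 2 * p) z w ≤ -(w - r * z) ^ 2 := by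
  unfold Ipp
  rw [one_div, inv_mul_eq_div, div_le_iff₀ hp]
  have hmin := limit_rate_minimizer hr hz hw
  set v := r * (w - r * z) / z with hv
  have hv0 : 0 ≤ v := div_nonneg (mul_nonneg hr.le (by linarith)) hz.le
  have hbdd : BddBelow ((fun θ : ℝ => z ^ 2 * θ + w ^ 2 * Lam p (r ^ 2 * p) θ) '' Set.Ici 0) := by
    refine ⟨p * (-(w - r * z) ^ 2
      - (Real.exp (p * (2 * w ^ 2 / z ^ 2)) / (1 - p) - 1) * w ^ 2), ?_⟩
    rintro _ ⟨θ, hθ, rfl⟩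
    exact rate_lower_bound hr hz hp hp2 hθ
  have hpv : 0 ≤ p * v := by positivity
  refine (csInf_le hbdd ⟨Real.log (1 + p * v), Real.log_nonneg (by linarith), rfl⟩).trans ?_
  have e1 := mul_le_mul_of_nonneg_left
    (Lam_log_one_add_le hp (by linarith) (by positivity : 0 < r ^ 2) hv0) (sq_nonneg w)
  have e2 := mul_le_mul_of_nonneg_left
    (Real.log_le_sub_one_of_pos (by linarith : 0 < 1 + p * v)) (sq_nonneg z)
  rw [← hmin]
  refine (add_le_add e2 e1).trans_eq ?_
  ring

/-- For `κ ∈ (0,∞)` and `w ≥ √κ z > 0`: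
`lim_{p→0⁺} I_{p,κp}(z,w) = inf_{v ≥ 0} (v z² - v w²/(κ+v)) = -(w - √κ z)²`. -/
theorem Ipp_limit (κ z w : ℝ) (hκ : 0 < κ)
    (hz : 0 < Real.sqrt κ * z) (hw : Real.sqrt κ * z ≤ w) :
    Tendsto (fun p : ℝ => Ipp p (κ * p) z w) (𝓝[>] (0:ℝ))
      (𝓝 (-(w - Real.sqrt κ * z) ^ 2)) ∧
    sInf ((fun v : ℝ => v * z ^ 2 - v * w ^ 2 / (κ + v)) '' Set.Ici (0:ℝ)) =
      -(w - Real.sqrt κ * z) ^ 2 := by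
  obtain ⟨r, hr, rfl⟩ : ∃ r : ℝ, 0 < r ∧ r ^ 2 = κ :=
    ⟨Real.sqrt κ, Real.sqrt_pos.mpr hκ, Real.sq_sqrt hκ.le⟩
  rw [Real.sqrt_sq hr.le] at *
  have hz0 : 0 < z := pos_of_mul_pos_right hz hr.le
  constructor
  · have hev : ∀ᶠ p : ℝ in 𝓝[>] 0, 0 < p ∧ p ≤ 1 / 2 := by
      filter_upwards [Ioc_mem_nhdsGT (show (0 : ℝ) < 1 / 2 by norm_num)] with p hp using hp
    have hlim : Tendsto
        (fun p : ℝ => -(w - r * z) ^ 2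
          - (Real.exp (p * (2 * w ^ 2 / z ^ 2)) / (1 - p) - 1) * w ^ 2)
        (𝓝[>] 0) (𝓝 (-(w - r * z) ^ 2)) := by
      have hc : ContinuousAt (fun p : ℝ => -(w - r * z) ^ 2
          - (Real.exp (p * (2 * w ^ 2 / z ^ 2)) / (1 - p) - 1) * w ^ 2) 0 := by
        have hne : (1 : ℝ) - 0 ≠ 0 := by norm_num
        fun_prop (disch := assumption)
      simpa using hc.tendsto.mono_left nhdsWithin_le_nhds
    refine tendsto_of_tendsto_of_tendsto_of_le_of_le' hlim tendsto_const_nhds ?_ ?_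
    · filter_upwards [hev] with p hp using le_Ipp hr hz0 hp.1 hp.2
    · filter_upwards [hev] with p hp using Ipp_le hr hz0 hw hp.1 hp.2
  · refine IsLeast.csInf_eq ⟨⟨r * (w - r * z) / z, ?_, limit_rate_minimizer hr hz0 hw⟩, ?_⟩
    · exact div_nonneg (mul_nonneg hr.le (by linarith)) hz0.le
    · rintro _ ⟨v, hv, rfl⟩
      exact neg_sq_le_limit_rate hr hv
end
end

section
/- Fix κ ∈ (0,∞) and real numbers z, w with w ≥ √κ · z > 0. For each sufficiently small p ∈ (0,1), let θ_p ∈ [0,∞) be the unique value with Λ'_{p,κp}(θ_p) = −(z/w)² (derivative in θ). Then, as p → 0⁺: θ_p/p → √κ · (w/z) − κ =: v⋆ ≥ 0, and p² Λ''_{p,κp}(θ_p) → 0. -/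
open Filter
open scoped Topology

noncomputable section

theorem hasDerivAt_Lam {p q θ : ℝ} (hA : 0 < (1 - p) * (Real.exp θ - 1) + q)
    (hB : 0 < Real.exp θ - 1 + q) :
    HasDerivAt (fun θ : ℝ => Lam p q θ)
      (Real.exp θ * ((1 - p) / ((1 - p) * (Real.exp θ - 1) + q) - 1 / (Real.exp θ - 1 + q))) θ := by
  have hden : HasDerivAt (fun θ : ℝ => Real.exp θ - 1 + q) (Real.exp θ) θ :=
    ((Real.hasDerivAt_exp θ).sub_const 1).add_const q
  have hF : 1 - p + p * q / (Real.exp θ - 1 + q)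
      = ((1 - p) * (Real.exp θ - 1) + q) / (Real.exp θ - 1 + q) := by
    field_simp
    ring
  have h := (((hasDerivAt_const θ (p * q)).div hden hB.ne').const_add (1 - p)).log
    (by
      change 1 - p + p * q / (Real.exp θ - 1 + q) ≠ 0
      rw [hF]
      exact (div_pos hA hB).ne')
  refine h.congr_deriv ?_
  change _ / (1 - p + p * q / (Real.exp θ - 1 + q)) = _
  rw [hF]
  generalize hA_def : (1 - p) * (Real.exp θ - 1) + q = A at hA ⊢
  have := hA.ne'
  have := hB.ne'
  field_simp
  rw [← hA_def]
  ring

theorem deriv_Lam {p q θ : ℝ} (hp : p < 1) (hq : 0 < q) (hθ : 0 ≤ θ) :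
    deriv (fun θ : ℝ => Lam p q θ) θ
      = Real.exp θ * ((1 - p) / ((1 - p) * (Real.exp θ - 1) + q) - 1 / (Real.exp θ - 1 + q)) := by
  have hx : 0 ≤ Real.exp θ - 1 := sub_nonneg.2 (Real.one_le_exp hθ)
  have hp' : 0 < 1 - p := sub_pos.2 hp
  exact (hasDerivAt_Lam (by positivity) (by positivity)).deriv

theorem deriv_deriv_Lam {p q θ : ℝ} (hp : p < 1) (hq : 0 < q) (hθ : 0 ≤ θ) :
    deriv (deriv (fun θ : ℝ => Lam p q θ)) θ
      = deriv (fun θ : ℝ => Lam p q θ) θ * (1 - Real.exp θ *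
        ((1 - p) / ((1 - p) * (Real.exp θ - 1) + q) + 1 / (Real.exp θ - 1 + q))) := by
  have hx : 0 ≤ Real.exp θ - 1 := sub_nonneg.2 (Real.one_le_exp hθ)
  have hp' : 0 < 1 - p := sub_pos.2 hp
  have hA : 0 < (1 - p) * (Real.exp θ - 1) + q := by positivity
  have hB : 0 < Real.exp θ - 1 + q := by positivity
  have hcA : ∀ᶠ t in 𝓝 θ, 0 < (1 - p) * (Real.exp t - 1) + q :=
    (by fun_prop : Continuous fun t : ℝ => (1 - p) * (Real.exp t - 1) + q).continuousAt.eventually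
      (lt_mem_nhds hA)
  have hcB : ∀ᶠ t in 𝓝 θ, 0 < Real.exp t - 1 + q :=
    (by fun_prop : Continuous fun t : ℝ => Real.exp t - 1 + q).continuousAt.eventually
      (lt_mem_nhds hB)
  have heq : deriv (fun θ : ℝ => Lam p q θ) =ᶠ[𝓝 θ] fun t => Real.exp t *
      ((1 - p) / ((1 - p) * (Real.exp t - 1) + q) - 1 / (Real.exp t - 1 + q)) := by
    filter_upwards [hcA, hcB] with t h1 h2 using (hasDerivAt_Lam h1 h2).deriv
  rw [heq.deriv_eq, deriv_Lam hp hq hθ]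
  have hE := (Real.hasDerivAt_exp θ).sub_const 1
  have h := (Real.hasDerivAt_exp θ).mul
    (((hasDerivAt_const θ (1 - p)).div ((hE.const_mul (1 - p)).add_const q) hA.ne').sub
      ((hasDerivAt_const θ (1 : ℝ)).div (hE.add_const q) hB.ne'))
  refine (h.congr_deriv ?_).deriv
  simp only [Pi.sub_apply, Pi.div_apply]
  have := hA.ne'
  have := hB.ne'
  field_simp
  ring

/-- In the rescaled variable `u = (e^θ - 1)/p`, the equation `Λ'_{p,κp}(θ) = -a` is quadratic. -/
theorem deriv_Lam_eq_neg_iff {κ p θ a : ℝ} (hκ : 0 < κ) (hp0 : 0 < p) (hp : p < 1)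
    (hθ : 0 ≤ θ) :
    deriv (fun θ : ℝ => Lam p (κ * p) θ) θ = -a ↔
      a * (((1 - p) * ((Real.exp θ - 1) / p) + κ) * ((Real.exp θ - 1) / p + κ))
        = κ * (1 + p * ((Real.exp θ - 1) / p)) := by
  obtain ⟨u, hu⟩ : ∃ u, u = (Real.exp θ - 1) / p := ⟨_, rfl⟩
  have hE : Real.exp θ = 1 + p * u := by rw [hu]; field_simp; ring
  have hu0 : 0 ≤ u := hu ▸ div_nonneg (sub_nonneg.2 (Real.one_le_exp hθ)) hp0.le
  have hp' : 0 < 1 - p := sub_pos.2 hp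
  have hA : 0 < (1 - p) * u + κ := by positivity
  have hB : 0 < u + κ := by positivity
  rw [deriv_Lam hp (by positivity) hθ, ← hu, hE]
  have key : (1 + p * u) * ((1 - p) / ((1 - p) * (1 + p * u - 1) + κ * p)
      - 1 / (1 + p * u - 1 + κ * p)) = -(κ * (1 + p * u) / (((1 - p) * u + κ) * (u + κ))) := by
    rw [show (1 - p) * (1 + p * u - 1) + κ * p = p * ((1 - p) * u + κ) by ring,
      show 1 + p * u - 1 + κ * p = p * (u + κ) by ring]
    have := hA.ne'
    have := hB.ne'
    field_simp
    ring
  rw [key, neg_inj, div_eq_iff (by positivity)]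
  exact eq_comm

theorem le_of_quadratic {κ a p u : ℝ} (hκ : 0 < κ) (ha : 0 < a) (hp0 : 0 < p)
    (hp : p ≤ 1 / 2) (hu : 0 ≤ u)
    (h : a * (((1 - p) * u + κ) * (u + κ)) = κ * (1 + p * u)) : u ≤ 1 + 4 * κ / a := by
  have hpos : 0 < 4 * κ / a := by positivity
  by_contra! hlt
  have h1 : 1 ≤ u := by linarith
  have h2 : 4 * κ < a * u := by
    have : 4 * κ / a < u := by linarith
    rw [div_lt_iff₀ ha] at this
    linarith
  have h3 : u / 2 * u ≤ ((1 - p) * u + κ) * (u + κ) := by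
    have : u / 2 ≤ (1 - p) * u + κ := by nlinarith
    have : u ≤ u + κ := by linarith
    have : 0 ≤ (1 - p) * u + κ := by linarith
    gcongr
  have h4 : κ * (1 + p * u) ≤ κ * (2 * u) := by
    have : p * u ≤ 1 / 2 * u := by gcongr
    gcongr
    linarith
  have h5 := mul_le_mul_of_nonneg_left h3 ha.le
  nlinarith

/-- Fix `κ ∈ (0,∞)` and `w ≥ √κ z > 0`.  If, for all sufficiently small `p > 0`,
`θ_p ∈ [0,∞)` is the value with `Λ'_{p,κp}(θ_p) = -(z/w)²`, then as `p → 0⁺`: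
`θ_p/p → √κ (w/z) - κ =: v⋆ ≥ 0` and `p² Λ''_{p,κp}(θ_p) → 0`. -/
theorem theta_p_asymptotics (κ z w : ℝ) (hκ : 0 < κ)
    (hz : 0 < Real.sqrt κ * z) (hw : Real.sqrt κ * z ≤ w)
    (θp : ℝ → ℝ)
    (hθ : ∀ᶠ p in 𝓝[>] (0:ℝ), 0 ≤ θp p ∧
      deriv (fun θ : ℝ => Lam p (κ * p) θ) (θp p) = -(z / w) ^ 2) :
    0 ≤ Real.sqrt κ * (w / z) - κ ∧
    Tendsto (fun p : ℝ => θp p / p) (𝓝[>] (0:ℝ))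
      (𝓝 (Real.sqrt κ * (w / z) - κ)) ∧
    Tendsto (fun p : ℝ => p ^ 2 * deriv (deriv (fun θ : ℝ => Lam p (κ * p) θ)) (θp p))
      (𝓝[>] (0:ℝ)) (𝓝 0) := by
  have hz' : 0 < z := pos_of_mul_pos_right hz (Real.sqrt_nonneg κ)
  have hw' : 0 < w := hz.trans_le hw
  have hsq : Real.sqrt κ * Real.sqrt κ = κ := Real.mul_self_sqrt hκ.le
  have hs : 0 < Real.sqrt κ := Real.sqrt_pos.2 hκ
  have ha : 0 < (z / w) ^ 2 := by positivity
  set a := (z / w) ^ 2 with ha_def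
  set l := 𝓝[>] (0 : ℝ)
  set u : ℝ → ℝ := fun p => (Real.exp (θp p) - 1) / p with hu_def
  have hlim : Tendsto (fun p : ℝ => p) l (𝓝 0) := tendsto_nhdsWithin_of_tendsto_nhds tendsto_id
  have hpos : ∀ᶠ p in l, 0 < p := self_mem_nhdsWithin
  have hsmall : ∀ᶠ p in l, p < 1 / 2 := hlim.eventually (gt_mem_nhds (by norm_num))
  have hexp : ∀ᶠ p in l, Real.exp (θp p) = 1 + p * u p := by
    filter_upwards [hpos] with p hp
    simp only [hu_def]
    field_simp
    ring
  have hu0 : ∀ᶠ p in l, 0 ≤ u p := by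
    filter_upwards [hpos, hθ] with p hp h
    exact div_nonneg (sub_nonneg.2 (Real.one_le_exp h.1)) hp.le
  have hquad : ∀ᶠ p in l, a * (((1 - p) * u p + κ) * (u p + κ)) = κ * (1 + p * u p) := by
    filter_upwards [hpos, hsmall, hθ] with p hp hp2 h
    exact (deriv_Lam_eq_neg_iff hκ hp (by linarith) h.1).1 h.2
  have hub : ∀ᶠ p in l, u p ≤ 1 + 4 * κ / a := by
    filter_upwards [hpos, hsmall, hu0, hquad] with p hp hp2 h0 hq
    exact le_of_quadratic hκ ha hp hp2.le h0 hq
  have hpu : Tendsto (fun p => p * u p) l (𝓝 0) := by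
    refine squeeze_zero' (g := fun p => p * (1 + 4 * κ / a)) ?_ ?_ ?_
    · filter_upwards [hpos, hu0] with p hp h using mul_nonneg hp.le h
    · filter_upwards [hpos, hub] with p hp h using mul_le_mul_of_nonneg_left h hp.le
    · simpa using hlim.mul_const (1 + 4 * κ / a)
  have hpuu : Tendsto (fun p => p * u p * u p) l (𝓝 0) := by
    refine squeeze_zero' (g := fun p => p * u p * (1 + 4 * κ / a)) ?_ ?_ ?_
    · filter_upwards [hpos, hu0] with p hp h using mul_nonneg (mul_nonneg hp.le h) h
    · filter_upwards [hpos, hu0, hub] with p hp h0 h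
        using mul_le_mul_of_nonneg_left h (mul_nonneg hp.le h0)
    · simpa using hpu.mul_const (1 + 4 * κ / a)
  have hu : Tendsto u l (𝓝 (Real.sqrt κ * (w / z) - κ)) := by
    have h1 : Tendsto (fun p =>
        Real.sqrt ((κ * (1 + p * u p) + a * (p * u p * u p + κ * (p * u p))) / a) - κ) l
        (𝓝 (Real.sqrt ((κ * (1 + 0) + a * (0 + κ * 0)) / a) - κ)) :=
      (((((hpu.const_add 1).const_mul κ).add
        ((hpuu.add (hpu.const_mul κ)).const_mul a)).div_const a).sqrt).sub_const κ
    have h2 : Real.sqrt ((κ * (1 + 0) + a * (0 + κ * 0)) / a) = Real.sqrt κ * (w / z) := by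
      rw [Real.sqrt_eq_iff_mul_self_eq (by positivity) (by positivity), ha_def]
      field_simp
      rw [Real.sq_sqrt hκ.le]
      ring
    rw [h2] at h1
    refine h1.congr' ?_
    filter_upwards [hu0, hquad] with p h0 hq
    have : (κ * (1 + p * u p) + a * (p * u p * u p + κ * (p * u p))) / a = (u p + κ) ^ 2 := by
      rw [div_eq_iff ha.ne', ← hq]
      ring
    rw [this, Real.sqrt_sq (by positivity)]
    ring
  refine ⟨?_, ?_, ?_⟩
  · rw [sub_nonneg, ← mul_div_assoc, le_div_iff₀ hz']
    nlinarith
  · refine tendsto_of_tendsto_of_tendsto_of_le_of_le' (g := fun p => u p / (1 + p * u p))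
      ?_ hu ?_ ?_
    · simpa [Pi.div_def] using hu.div (hpu.const_add 1) (by norm_num)
    · filter_upwards [hpos, hu0, hexp] with p hp h0 he
      have hone : 0 < 1 + p * u p := by positivity
      have h := Real.add_one_le_exp (-θp p)
      rw [Real.exp_neg, he] at h
      rw [div_le_div_iff₀ hone hp]
      have h' := mul_le_mul_of_nonneg_right h hone.le
      rw [inv_mul_cancel₀ hone.ne'] at h'
      linarith
    · filter_upwards [hpos, hexp] with p hp he
      rw [div_le_iff₀ hp]
      linarith [Real.add_one_le_exp (θp p)]
  · have hv : Real.sqrt κ * (w / z) - κ + κ ≠ 0 := by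
      rw [sub_add_cancel]
      positivity
    have hA : Tendsto (fun p => (1 - p) * u p + κ) l (𝓝 (Real.sqrt κ * (w / z) - κ + κ)) := by
      simpa using ((hlim.const_sub 1).mul hu).add_const κ
    have hlim' : Tendsto (fun p => -a * (p ^ 2 - p * (1 + p * u p) *
        ((1 - p) / ((1 - p) * u p + κ) + 1 / (u p + κ)))) l (𝓝 0) := by
      simpa using ((hlim.pow 2).sub ((hlim.mul (hpu.const_add 1)).mul
        (((hlim.const_sub 1).div hA hv).add
          ((tendsto_const_nhds (x := (1 : ℝ))).div (hu.add_const κ) hv)))).const_mul (-a)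
    refine hlim'.congr' ?_
    filter_upwards [hpos, hsmall, hu0, hexp, hθ] with p hp hp2 h0 he h
    rw [deriv_deriv_Lam (by linarith) (by positivity) h.1, h.2, he]
    have hp' : 0 < 1 - p := by linarith
    have hA' : (1 - p) * u p + κ ≠ 0 := by positivity
    have hB' : u p + κ ≠ 0 := by positivity
    rw [show (1 - p) * (1 + p * u p - 1) + κ * p = p * ((1 - p) * u p + κ) by ring,
      show 1 + p * u p - 1 + κ * p = p * (u p + κ) by ring]
    field_simp
end
end

section
/- Fix s ≥ 1, κ ∈ (0,∞), a constant β > 0, and real numbers z, w with w ≥ √κ · z > 0. Let (p_n) ⊂ (0,1) be a sequence such that (p_n log n) is bounded above and bounded away from zero, set N_n = 2 s (log n)² / β, and let Z_n = Σ_{i=1}^{⌊w² N_n⌋} J_i (1 + Y_i), where the J_i are i.i.d. Bernoulli(p_n) random variables independent of the i.i.d. Geometric(κ p_n) random variables Y_i (taking values in {0,1,2,…} with P[Y_i = ℓ] = κp_n(1−κp_n)^ℓ). Then lim_{n→∞} (1/(p_n N_n)) · log P[ Z_n ≤ z² N_n ] = − (w − √κ z)². -/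
open Filter
open scoped Topology

noncomputable section

/-- Probability mass function of `J(1+Y)` where `J` is Bernoulli(`p`) independent of the
Geometric(`p'`) variable `Y` (with `P[Y = ℓ] = p'(1-p')^ℓ` on `{0,1,2,…}`). -/
def mass (p p' : ℝ) : ℕ → ℝ
  | 0 => 1 - p
  | k + 1 => p * (p' * (1 - p') ^ k)

/-- Probability mass function of the sum of `m` i.i.d. copies of `J(1+Y)`
(`m`-fold convolution of `mass p p'`). -/
def convPMF (p p' : ℝ) : ℕ → ℕ → ℝ
  | 0, k => if k = 0 then 1 else 0
  | m + 1, k => ∑ j ∈ Finset.range (k + 1), convPMF p p' m j * mass p p' (k - j)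

/-- `P[ Σ_{i=1}^m J_i(1+Y_i) ≤ c ]` for `c ≥ 0`. -/
def probLE (p p' : ℝ) (m : ℕ) (c : ℝ) : ℝ :=
  ∑ k ∈ Finset.range (Nat.floor c + 1), convPMF p p' m k

theorem probLE_natCast (p p' : ℝ) (m K : ℕ) :
    probLE p p' m K = ∑ k ∈ Finset.range (K + 1), convPMF p p' m k := by
  simp [probLE]

theorem probLE_natCast_zero (p p' : ℝ) (K : ℕ) : probLE p p' 0 K = 1 := by
  simp [probLE_natCast, convPMF]

/-- The part of `P[Z ≤ K]` due to one further nonzero summand. -/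
def geomConv (p p' : ℝ) (m K : ℕ) : ℝ :=
  ∑ l ∈ Finset.range K, p' * (1 - p') ^ l * probLE p p' m (K - (l + 1) : ℕ)

theorem geomConv_zero (p p' : ℝ) (m : ℕ) : geomConv p p' m 0 = 0 := by simp [geomConv]

theorem geomConv_succ (p p' : ℝ) (m K : ℕ) :
    geomConv p p' m (K + 1) = p' * probLE p p' m K + (1 - p') * geomConv p p' m K := by
  rw [geomConv, Finset.sum_range_succ', geomConv, Finset.mul_sum, add_comm]
  congr 1
  · simp
  · refine Finset.sum_congr rfl fun l _ => ?_
    rw [Nat.add_sub_add_right, pow_succ]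
    ring

theorem probLE_natCast_succ (p p' : ℝ) (m K : ℕ) :
    probLE p p' (m + 1) K = (1 - p) * probLE p p' m K + p * geomConv p p' m K := by
  have hconv : ∀ k, convPMF p p' (m + 1) k =
      ∑ j ∈ Finset.range (k + 1), mass p p' j * convPMF p p' m (k - j) := by
    intro k
    rw [convPMF, ← Finset.sum_range_reflect]
    refine Finset.sum_congr rfl fun j hj => ?_
    have hj' : j ≤ k := Nat.lt_succ_iff.mp (Finset.mem_range.mp hj)
    rw [Nat.add_sub_cancel, Nat.sub_sub_self hj', mul_comm]
  rw [probLE_natCast, Finset.sum_congr rfl fun k _ => hconv k,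
    Finset.sum_range_diag_flip (K + 1) fun i j => mass p p' i * convPMF p p' m j,
    Finset.sum_range_succ', add_comm, geomConv, Finset.mul_sum]
  congr 1
  · simp [mass, probLE_natCast, Finset.mul_sum]
  · refine Finset.sum_congr rfl fun l hl => ?_
    have hl' : l < K := Finset.mem_range.mp hl
    rw [probLE_natCast, ← Finset.mul_sum,
      show K - (l + 1) + 1 = K + 1 - (l + 1) by omega, mass]
    ring

/-- The binomial probability `P[Bin(m, p) = k]`. -/
def binomMass (p : ℝ) : ℕ → ℕ → ℝ
  | 0, 0 => 1
  | 0, _ + 1 => 0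
  | m + 1, 0 => (1 - p) * binomMass p m 0
  | m + 1, k + 1 => (1 - p) * binomMass p m (k + 1) + p * binomMass p m k

theorem binomMass_add (p : ℝ) (d k : ℕ) :
    binomMass p (d + k) k = (d + k).choose k * p ^ k * (1 - p) ^ d := by
  have hzero : ∀ m k, m < k → binomMass p m k = 0 := by
    intro m
    induction m with
    | zero => intro k hk; obtain ⟨k, rfl⟩ := Nat.exists_eq_succ_of_ne_zero hk.ne'; rfl
    | succ m ih =>
      intro k hk
      obtain ⟨k, rfl⟩ := Nat.exists_eq_succ_of_ne_zero (by omega : k ≠ 0)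
      rw [Nat.succ_eq_add_one, binomMass, ih _ (by omega), ih _ (by omega)]
      simp
  induction k generalizing d with
  | zero =>
    induction d with
    | zero => simp [binomMass]
    | succ d ih =>
      simp only [add_zero, Nat.choose_zero_right, pow_zero] at ih ⊢
      rw [binomMass, ih, pow_succ]
      ring
  | succ k ihk =>
    induction d with
    | zero =>
      have h := ihk 0
      simp only [zero_add, Nat.choose_self] at h ⊢
      rw [binomMass, hzero _ _ (Nat.lt_succ_self k), h, pow_succ]
      ring
    | succ d ihd =>
      have h := ihk (d + 1)
      rw [show d + 1 + k = d + (k + 1) by ring] at h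
      rw [show d + 1 + (k + 1) = d + (k + 1) + 1 by ring, binomMass, ihd, h,
        Nat.choose_succ_succ]
      push_cast
      ring

theorem binomMass_nonneg {p : ℝ} (h0 : 0 ≤ p) (h1 : p ≤ 1) (m k : ℕ) : 0 ≤ binomMass p m k := by
  have h2 : 0 ≤ 1 - p := sub_nonneg.mpr h1
  induction m generalizing k with
  | zero => cases k <;> simp [binomMass]
  | succ m ih =>
    cases k with
    | zero => exact mul_nonneg h2 (ih 0)
    | succ k => exact add_nonneg (mul_nonneg h2 (ih _)) (mul_nonneg h0 (ih _))

theorem binomMass_le_one {p : ℝ} (h0 : 0 ≤ p) (h1 : p ≤ 1) (m k : ℕ) : binomMass p m k ≤ 1 := by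
  have h2 : 0 ≤ 1 - p := sub_nonneg.mpr h1
  induction m generalizing k with
  | zero => cases k <;> simp [binomMass]
  | succ m ih =>
    cases k with
    | zero => rw [binomMass]; nlinarith [ih 0]
    | succ k => rw [binomMass]; nlinarith [ih k, ih (k + 1)]

theorem binomMass_mul_le_probLE {p p' : ℝ} (h0 : 0 ≤ p) (h1 : p ≤ 1) (h0' : 0 ≤ p')
    (h1' : p' ≤ 1) (m k K : ℕ) :
    binomMass p m k * binomMass p' K k ≤ probLE p p' m K := by
  have h2 : 0 ≤ 1 - p := sub_nonneg.mpr h1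
  have h2' : 0 ≤ 1 - p' := sub_nonneg.mpr h1'
  induction m generalizing k K with
  | zero =>
    rw [probLE_natCast_zero]
    exact mul_le_one₀ (binomMass_le_one h0 h1 _ _) (binomMass_nonneg h0' h1' _ _)
      (binomMass_le_one h0' h1' _ _)
  | succ m ih =>
    rw [probLE_natCast_succ]
    cases k with
    | zero =>
      have hR : 0 ≤ geomConv p p' m K :=
        Finset.sum_nonneg fun l _ => mul_nonneg (mul_nonneg h0' (pow_nonneg h2' _))
          ((mul_nonneg (binomMass_nonneg h0 h1 _ _) (binomMass_nonneg h0' h1' _ _)).trans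
            (ih 0 _))
      rw [binomMass, mul_assoc]
      exact le_add_of_le_of_nonneg (mul_le_mul_of_nonneg_left (ih 0 K) h2) (mul_nonneg h0 hR)
    | succ k =>
      have hR : binomMass p m k * binomMass p' K (k + 1) ≤ geomConv p p' m K := by
        clear h2
        induction K with
        | zero => simp [geomConv_zero, binomMass]
        | succ K ihK =>
          rw [geomConv_succ, binomMass]
          nlinarith [mul_le_mul_of_nonneg_left (ih k K) h0', mul_le_mul_of_nonneg_left ihK h2']
      rw [binomMass]
      nlinarith [mul_le_mul_of_nonneg_left (ih (k + 1) K) h2, mul_le_mul_of_nonneg_left hR h0]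

theorem probLE_le_pow_mul_pow {p p' u : ℝ} (h0 : 0 ≤ p) (h1 : p ≤ 1) (h0' : 0 < p')
    (h1' : p' ≤ 1) (hu : 0 ≤ u) (m K : ℕ) :
    probLE p p' m K ≤ (1 + u) ^ K * (1 - p * (u / (u + p'))) ^ m := by
  have h2 : 0 ≤ 1 - p := sub_nonneg.mpr h1
  have h2' : 0 ≤ 1 - p' := sub_nonneg.mpr h1'
  have hpos : 0 < u + p' := by linarith
  induction m generalizing K with
  | zero =>
    rw [probLE_natCast_zero, pow_zero, mul_one]
    exact one_le_pow₀ (by linarith)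
  | succ m ih =>
    set φ := 1 - p * (u / (u + p')) with hφ
    have hφ0 : 0 ≤ φ := by
      have : u / (u + p') ≤ 1 := (div_le_one hpos).mpr (by linarith)
      nlinarith
    have hR : geomConv p p' m K ≤ p' / (u + p') * ((1 + u) ^ K * φ ^ m) := by
      induction K with
      | zero => rw [geomConv_zero]; positivity
      | succ K ihK =>
        rw [geomConv_succ]
        refine (add_le_add (mul_le_mul_of_nonneg_left (ih K) h0'.le)
          (mul_le_mul_of_nonneg_left ihK h2')).trans (le_of_eq ?_)
        rw [pow_succ]
        field_simp
        ring
    rw [probLE_natCast_succ]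
    refine (add_le_add (mul_le_mul_of_nonneg_left (ih K) h2)
      (mul_le_mul_of_nonneg_left hR h0)).trans (le_of_eq ?_)
    rw [pow_succ, hφ]
    field_simp
    ring

theorem log_factorial_le {k : ℕ} (hk : 1 ≤ k) :
    Real.log (k.factorial) ≤ k * Real.log k - k + Real.log k + 1 := by
  induction k, hk using Nat.le_induction with
  | base => simp
  | succ k hk ih =>
    have hk0 : (0 : ℝ) < k := by exact_mod_cast hk
    have h := Real.one_sub_inv_le_log_of_pos (show (0 : ℝ) < (k + 1) / k by positivity)
    rw [Real.log_div (by positivity) hk0.ne', inv_div,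
      show 1 - (k : ℝ) / (k + 1) = 1 / (k + 1) by field_simp; ring,
      div_le_iff₀ (by positivity)] at h
    rw [Nat.factorial_succ, Nat.cast_mul, Real.log_mul (by positivity) (by positivity)]
    push_cast
    nlinarith

theorem le_log_binomMass {p : ℝ} (h0 : 0 < p) (h1 : p < 1) {m k : ℕ} (hk : 1 ≤ k) (hkm : k < m) :
    0 < binomMass p m k ∧
    k * Real.log ((m - k) * p / k) + k - Real.log k - 1 - m * (p / (1 - p)) ≤
      Real.log (binomMass p m k) := by
  obtain ⟨d, rfl⟩ := Nat.exists_eq_add_of_lt hkm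
  have h2 : 0 < 1 - p := sub_pos.mpr h1
  have hk0 : (0 : ℝ) < k := by exact_mod_cast hk
  rw [show k + d + 1 = (d + 1) + k by ring, binomMass_add]
  have hc : (0 : ℝ) < ((d + 1 + k).choose k : ℝ) := by
    exact_mod_cast Nat.choose_pos (Nat.le_add_left k (d + 1))
  refine ⟨by positivity, ?_⟩
  have hpow : ((d + 1 : ℕ) : ℝ) ^ k ≤ k.factorial * (d + 1 + k).choose k := by
    have h := Nat.pow_le_choose (α := ℝ) k (d + 1 + k)
    rw [div_le_iff₀' (by positivity)] at h
    refine le_trans ?_ h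
    gcongr
    omega
  have hlog := Real.log_le_log (by positivity) hpow
  rw [Real.log_pow, Real.log_mul (by positivity) hc.ne'] at hlog
  have hfac := log_factorial_le hk
  have hq := Real.one_sub_inv_le_log_of_pos h2
  have hq' : 1 - (1 - p)⁻¹ = -(p / (1 - p)) := by field_simp; ring
  rw [hq'] at hq
  have hq2 := mul_le_mul_of_nonneg_left hq (show (0 : ℝ) ≤ (d + 1 : ℕ) by positivity)
  have hr : 0 ≤ (k : ℝ) * (p / (1 - p)) := by positivity
  rw [Real.log_mul (by positivity) (by positivity), Real.log_mul hc.ne' (by positivity),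
    Real.log_pow, Real.log_pow]
  have hd : ((d + 1 + k : ℕ) : ℝ) - k = (d + 1 : ℕ) := by push_cast; ring
  rw [hd, Real.log_div (by positivity) (by positivity), Real.log_mul (by positivity) h0.ne']
  push_cast at *
  nlinarith

/-- Poisson-type lower bound on binomial probabilities in the regime `p → 0`, `p * N → ∞`. -/
theorem binomMass_lower_asymptotics {p N : ℕ → ℝ} {m k : ℕ → ℕ} {a ν : ℝ}
    (ha : 0 < a) (hν : 0 < ν) (hp0 : ∀ᶠ n in atTop, 0 < p n) (hp : Tendsto p atTop (𝓝 0))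
    (hN : ∀ᶠ n in atTop, 0 < N n) (hpN : Tendsto (fun n => p n * N n) atTop atTop)
    (hm : Tendsto (fun n => (m n : ℝ) / N n) atTop (𝓝 a))
    (hk : Tendsto (fun n => (k n : ℝ) / (p n * N n)) atTop (𝓝 ν)) :
    ∃ g : ℕ → ℝ, Tendsto g atTop (𝓝 (ν * Real.log (a / ν) + ν - a)) ∧
      ∀ᶠ n in atTop, 0 < binomMass (p n) (m n) (k n) ∧
        g n ≤ 1 / (p n * N n) * Real.log (binomMass (p n) (m n) (k n)) := by
  have hkinf : Tendsto (fun n => (k n : ℝ)) atTop atTop := by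
    refine (hk.pos_mul_atTop hν hpN).congr' ?_
    filter_upwards [hp0, hN] with n h1 h2
    field_simp
  have hlogk : Tendsto (fun n => Real.log (k n) / k n) atTop (𝓝 0) :=
    (Real.isLittleO_log_id_atTop.tendsto_div_nhds_zero).comp hkinf
  have hratio : Tendsto (fun n => (m n / N n - k n / (p n * N n) * p n) / (k n / (p n * N n)))
      atTop (𝓝 ((a - ν * 0) / ν)) := (hm.sub (hk.mul hp)).div hk hν.ne'
  rw [mul_zero, sub_zero] at hratio
  have hinv : Tendsto (fun n => 1 / (p n * N n)) atTop (𝓝 0) :=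
    hpN.const_div_atTop 1
  have h1p : Tendsto (fun n => m n / N n * (1 / (1 - p n))) atTop (𝓝 (a * (1 / (1 - 0)))) :=
    hm.mul (tendsto_const_nhds.div (tendsto_const_nhds.sub hp) (by norm_num))
  refine ⟨fun n => k n / (p n * N n) *
      Real.log ((m n / N n - k n / (p n * N n) * p n) / (k n / (p n * N n))) + k n / (p n * N n)
      - Real.log (k n) / k n * (k n / (p n * N n)) - 1 / (p n * N n)
      - m n / N n * (1 / (1 - p n)), ?_, ?_⟩
  · have := ((((hk.mul (hratio.log (by positivity))).add hk).sub (hlogk.mul hk)).sub hinv).sub h1p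
    simpa using this
  · have hlt : ∀ᶠ n in atTop, k n / (p n * N n) * p n < m n / N n := by
      have h := hk.mul hp
      rw [mul_zero] at h
      exact h.eventually_lt hm ha
    filter_upwards [hp0, hN, hlt, hp.eventually_lt_const one_pos, hkinf.eventually_ge_atTop 1]
      with n h1 h2 h3 h4 h5
    have hk1 : 1 ≤ k n := by exact_mod_cast h5
    have hkm : k n < m n := by
      have : (k n : ℝ) / (p n * N n) * p n = k n / N n := by field_simp
      rw [this, div_lt_div_iff_of_pos_right h2] at h3
      exact_mod_cast h3
    obtain ⟨hpos, hle⟩ := le_log_binomMass h1 h4 hk1 hkm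
    refine ⟨hpos, le_trans (le_of_eq ?_)
      (mul_le_mul_of_nonneg_left hle (by positivity : 0 ≤ 1 / (p n * N n)))⟩
    have hk0 : (k n : ℝ) ≠ 0 := by positivity
    have h6 : 1 - p n ≠ 0 := by linarith
    have h7 : (m n / N n - k n / (p n * N n) * p n) / (k n / (p n * N n)) =
        (m n - k n) * p n / k n := by
      field_simp
    rw [h7]
    generalize Real.log ((m n - k n) * p n / k n) = L
    field_simp

theorem log_probLE_lower_asymptotics {p N : ℕ → ℝ} {κ z w : ℝ} (hκ : 0 < κ) (hz : 0 < z)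
    (hw : 0 < w) (hp0 : ∀ n, 0 < p n) (hp : Tendsto p atTop (𝓝 0))
    (hN : Tendsto N atTop atTop) (hpN : Tendsto (fun n => p n * N n) atTop atTop) :
    ∃ g : ℕ → ℝ, Tendsto g atTop (𝓝 (-(w - √κ * z) ^ 2)) ∧
      ∀ᶠ n in atTop,
        0 < probLE (p n) (κ * p n) ⌊w ^ 2 * N n⌋₊ (z ^ 2 * N n) ∧
        g n ≤ 1 / (p n * N n) *
          Real.log (probLE (p n) (κ * p n) ⌊w ^ 2 * N n⌋₊ (z ^ 2 * N n)) := by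
  have hsκ : 0 < √κ := Real.sqrt_pos.mpr hκ
  set ν := w * (√κ * z) with hνdef
  have hν : 0 < ν := by positivity
  have hN0 := hN.eventually_gt_atTop 0
  have hfloor : ∀ a : ℝ, 0 < a → ∀ {x : ℕ → ℝ}, Tendsto x atTop atTop →
      Tendsto (fun n => (⌊a * x n⌋₊ : ℝ) / x n) atTop (𝓝 a) := fun a ha x hx =>
    (tendsto_nat_floor_mul_div_atTop ha.le).comp hx
  have hk := hfloor ν hν hpN
  obtain ⟨g₁, hg₁, hle₁⟩ := binomMass_lower_asymptotics (a := w ^ 2) (by positivity) hν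
    (Eventually.of_forall hp0) hp hN0 hpN (hfloor (w ^ 2) (by positivity) hN) hk
  have hκp : Tendsto (fun n => κ * p n) atTop (𝓝 0) := by simpa using hp.const_mul κ
  have hκpN : Tendsto (fun n => κ * p n * N n) atTop atTop := by
    simpa only [mul_assoc] using hpN.const_mul_atTop hκ
  have hk' : Tendsto (fun n => (⌊ν * (p n * N n)⌋₊ : ℝ) / (κ * p n * N n)) atTop
      (𝓝 (ν / κ)) := by
    refine (hk.div_const κ).congr fun n => ?_
    rw [div_div]
    congr 1
    ring
  obtain ⟨g₂, hg₂, hle₂⟩ := binomMass_lower_asymptotics (a := z ^ 2) (by positivity)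
    (by positivity) (Eventually.of_forall fun n => mul_pos hκ (hp0 n)) hκp hN0 hκpN
    (hfloor (z ^ 2) (by positivity) hN) hk'
  refine ⟨fun n => g₁ n + κ * g₂ n, ?_, ?_⟩
  · convert hg₁.add (hg₂.const_mul κ) using 2
    have hsq : √κ * √κ = κ := Real.mul_self_sqrt hκ.le
    have e₁ : w ^ 2 / ν = w / (√κ * z) := by rw [hνdef]; field_simp
    have e₂ : z ^ 2 / (ν / κ) = (w / (√κ * z))⁻¹ := by
      rw [hνdef, inv_div]
      field_simp
      nlinarith
    rw [e₁, e₂, Real.log_inv]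
    have e₃ : κ * (ν / κ * -Real.log (w / (√κ * z)) + ν / κ - z ^ 2) =
        -(ν * Real.log (w / (√κ * z))) + ν - κ * z ^ 2 := by
      field_simp
    rw [e₃, hνdef]
    linear_combination (-(z ^ 2)) * hsq
  · filter_upwards [hle₁, hle₂, hN0, hp.eventually_lt_const one_pos,
      hκp.eventually_lt_const one_pos] with n h₁ h₂ h₃ h₄ h₅
    have hpn := hp0 n
    have hbin := binomMass_mul_le_probLE hpn.le h₄.le (mul_pos hκ hpn).le h₅.le
      ⌊w ^ 2 * N n⌋₊ ⌊ν * (p n * N n)⌋₊ ⌊z ^ 2 * N n⌋₊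
    have hfl : probLE (p n) (κ * p n) ⌊w ^ 2 * N n⌋₊ (⌊z ^ 2 * N n⌋₊ : ℕ) =
        probLE (p n) (κ * p n) ⌊w ^ 2 * N n⌋₊ (z ^ 2 * N n) := by simp [probLE]
    rw [hfl] at hbin
    refine ⟨(mul_pos h₁.1 h₂.1).trans_le hbin, ?_⟩
    have hlog := Real.log_le_log (mul_pos h₁.1 h₂.1) hbin
    rw [Real.log_mul h₁.1.ne' h₂.1.ne'] at hlog
    refine le_trans ?_ (mul_le_mul_of_nonneg_left hlog (by positivity : 0 ≤ 1 / (p n * N n)))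
    rw [mul_add]
    refine add_le_add h₁.2 ((mul_le_mul_of_nonneg_left h₂.2 hκ.le).trans (le_of_eq ?_))
    field_simp

theorem log_probLE_le {p κ z w N : ℝ} (hκ : 0 < κ) (hz : 0 < z) (hw : √κ * z ≤ w)
    (h0 : 0 < p) (h1 : p ≤ 1) (h1' : κ * p ≤ 1) (hN : 0 < N)
    (hpos : 0 < probLE p (κ * p) ⌊w ^ 2 * N⌋₊ (z ^ 2 * N)) :
    1 / (p * N) * Real.log (probLE p (κ * p) ⌊w ^ 2 * N⌋₊ (z ^ 2 * N)) ≤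
      -(w - √κ * z) ^ 2 + 1 / N := by
  have hsκ : 0 < √κ := Real.sqrt_pos.mpr hκ
  have hsq : √κ * √κ = κ := Real.mul_self_sqrt hκ.le
  have hw0 : 0 < w := lt_of_lt_of_le (by positivity) hw
  set θ := √κ * w / z - κ with hθ
  have hθ0 : 0 ≤ θ := by
    rw [hθ, sub_nonneg, le_div_iff₀ hz]
    nlinarith [mul_le_mul_of_nonneg_left hw hsκ.le]
  set r := θ / (θ + κ) with hr
  have hr0 : 0 ≤ r := by positivity
  have hr1 : r ≤ 1 := (div_le_one (by positivity)).mpr (by linarith)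
  set M := ⌊w ^ 2 * N⌋₊
  set K := ⌊z ^ 2 * N⌋₊ with hK
  have hfl : probLE p (κ * p) M (K : ℕ) = probLE p (κ * p) M (z ^ 2 * N) := by simp [probLE, hK]
  have hub := probLE_le_pow_mul_pow h0.le h1 (mul_pos hκ h0) h1' (mul_nonneg hθ0 h0.le) M K
  have hrp : θ * p / (θ * p + κ * p) = r := by
    rw [hr, ← add_mul, mul_div_mul_right _ _ h0.ne']
  rw [hfl, hrp] at hub
  have he₁ : (1 + θ * p) ^ K ≤ Real.exp (K * (θ * p)) := by
    rw [Real.exp_nat_mul]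
    refine pow_le_pow_left₀ (by positivity) ?_ _
    linarith [Real.add_one_le_exp (θ * p)]
  have hpr : 0 ≤ 1 - p * r := by nlinarith
  have he₂ : (1 - p * r) ^ M ≤ Real.exp (M * -(p * r)) := by
    rw [Real.exp_nat_mul]
    refine pow_le_pow_left₀ hpr ?_ _
    linarith [Real.add_one_le_exp (-(p * r))]
  have hlog : Real.log (probLE p (κ * p) M (z ^ 2 * N)) ≤ K * (θ * p) + M * -(p * r) := by
    rw [Real.log_le_iff_le_exp hpos, Real.exp_add]
    exact hub.trans (mul_le_mul he₁ he₂ (pow_nonneg hpr _) (Real.exp_pos _).le)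
  have hKle : (K : ℝ) ≤ z ^ 2 * N := Nat.floor_le (by positivity)
  have hMge : w ^ 2 * N - 1 ≤ (M : ℝ) := (Nat.sub_one_lt_floor _).le
  have hvalue : θ * z ^ 2 - w ^ 2 * r = -(w - √κ * z) ^ 2 := by
    have hr' : r = 1 - √κ * z / w := by
      have : θ + κ = √κ * w / z := by rw [hθ]; ring
      rw [hr, this, hθ]
      field_simp
      nlinarith
    rw [hr', hθ]
    field_simp
    nlinarith
  rw [one_div_mul_eq_div, div_le_iff₀ (by positivity)]
  calc Real.log (probLE p (κ * p) M (z ^ 2 * N))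
      ≤ K * (θ * p) + M * -(p * r) := hlog
    _ ≤ z ^ 2 * N * (θ * p) + -((w ^ 2 * N - 1) * (p * r)) := by
      have := mul_le_mul_of_nonneg_right hKle (mul_nonneg hθ0 h0.le)
      have := mul_le_mul_of_nonneg_right hMge (mul_nonneg h0.le hr0)
      linarith
    _ = (θ * z ^ 2 - w ^ 2 * r) * (p * N) + p * r := by ring
    _ ≤ (θ * z ^ 2 - w ^ 2 * r) * (p * N) + p := by nlinarith
    _ = (-(w - √κ * z) ^ 2 + 1 / N) * (p * N) := by rw [hvalue]; field_simp

/-- The large-deviation limit along any scale `N` with `N → ∞`, `p → 0` and `p * N → ∞`. -/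
theorem tendsto_log_probLE {p N : ℕ → ℝ} {κ z w : ℝ} (hκ : 0 < κ) (hz : 0 < z)
    (hw : √κ * z ≤ w) (hp0 : ∀ n, 0 < p n) (hp : Tendsto p atTop (𝓝 0))
    (hN : Tendsto N atTop atTop) (hpN : Tendsto (fun n => p n * N n) atTop atTop) :
    Tendsto (fun n => 1 / (p n * N n) *
        Real.log (probLE (p n) (κ * p n) ⌊w ^ 2 * N n⌋₊ (z ^ 2 * N n)))
      atTop (𝓝 (-(w - √κ * z) ^ 2)) := by
  have hw0 : 0 < w := lt_of_lt_of_le (mul_pos (Real.sqrt_pos.mpr hκ) hz) hw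
  obtain ⟨g, hg, hle⟩ := log_probLE_lower_asymptotics hκ hz hw0 hp0 hp hN hpN
  have hκp : Tendsto (fun n => κ * p n) atTop (𝓝 0) := by simpa using hp.const_mul κ
  have hupper : Tendsto (fun n => -(w - √κ * z) ^ 2 + 1 / N n) atTop
      (𝓝 (-(w - √κ * z) ^ 2)) := by
    simpa using (tendsto_const_nhds (x := -(w - √κ * z) ^ 2)).add hN.inv_tendsto_atTop
  refine tendsto_of_tendsto_of_tendsto_of_le_of_le' hg hupper (hle.mono fun n h => h.2) ?_
  filter_upwards [hle, hN.eventually_gt_atTop 0, hp.eventually_lt_const one_pos,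
    hκp.eventually_lt_const one_pos] with n h₁ h₂ h₃ h₄
  exact log_probLE_le hκ hz hw (hp0 n) h₃.le h₄.le h₂ h₁.1

/-- Lemma 5.4: with `N_n = 2s(log n)²/β` and `Z_n = Σ_{i=1}^{⌊w²N_n⌋} J_i(1+Y_i)`,
`J_i` i.i.d. Bernoulli(`p_n`) independent of `Y_i` i.i.d. Geometric(`κ p_n`), if
`p_n log n` is bounded above and away from zero then
`(1/(p_n N_n)) log P[Z_n ≤ z² N_n] → -(w - √κ z)²`. -/
theorem cramer_excursion (s κ β z w : ℝ) (hs : 1 ≤ s) (hκ : 0 < κ) (hβ : 0 < β)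
    (hz : 0 < Real.sqrt κ * z) (hw : Real.sqrt κ * z ≤ w)
    (p : ℕ → ℝ) (hp : ∀ n, p n ∈ Set.Ioo (0:ℝ) 1)
    (hbd : ∃ c C : ℝ, 0 < c ∧ ∀ n : ℕ, 2 ≤ n →
      c ≤ p n * Real.log n ∧ p n * Real.log n ≤ C) :
    Tendsto (fun n : ℕ =>
        (1 / (p n * (2 * s * Real.log n ^ 2 / β))) *
          Real.log (probLE (p n) (κ * p n)
            (Nat.floor (w ^ 2 * (2 * s * Real.log n ^ 2 / β)))
            (z ^ 2 * (2 * s * Real.log n ^ 2 / β))))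
      atTop (𝓝 (-(w - Real.sqrt κ * z) ^ 2)) := by
  obtain ⟨c, C, hc, hcC⟩ := hbd
  have hz0 : 0 < z := pos_of_mul_pos_right hz (Real.sqrt_nonneg κ)
  have hlog : Tendsto (fun n : ℕ => Real.log n) atTop atTop :=
    Real.tendsto_log_atTop.comp tendsto_natCast_atTop_atTop
  have hA : 0 < 2 * s / β := by positivity
  have hp0 : Tendsto p atTop (𝓝 0) := by
    refine tendsto_of_tendsto_of_tendsto_of_le_of_le' tendsto_const_nhds
      (hlog.const_div_atTop C) (Eventually.of_forall fun n => (hp n).1.le) ?_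
    filter_upwards [eventually_ge_atTop 2, hlog.eventually_gt_atTop 0] with n h2 hpos
    exact (le_div_iff₀ hpos).mpr (hcC n h2).2
  have hN : Tendsto (fun n : ℕ => 2 * s * Real.log n ^ 2 / β) atTop atTop := by
    refine (((tendsto_pow_atTop two_ne_zero).comp hlog).const_mul_atTop hA).congr fun n => ?_
    simp only [Function.comp_apply]
    ring
  have hpN : Tendsto (fun n : ℕ => p n * (2 * s * Real.log n ^ 2 / β)) atTop atTop := by
    refine tendsto_atTop_mono' _ ?_ (hlog.const_mul_atTop (mul_pos hA hc))
    filter_upwards [eventually_ge_atTop 2, hlog.eventually_gt_atTop 0] with n h2 hpos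
    calc 2 * s / β * c * Real.log n ≤ 2 * s / β * (p n * Real.log n) * Real.log n := by
          gcongr
          exact (hcC n h2).1
      _ = p n * (2 * s * Real.log n ^ 2 / β) := by ring
  exact tendsto_log_probLE hκ hz0 hw (fun n => (hp n).1) hp0 hN hpN
end
end

section
/- The integral over the open unit ball B(0,1) ⊂ ℝ³ of the function u ↦ 1/|u − e₃|, with respect to Lebesgue measure, equals 4π/3, where e₃ = (0,0,1) and |·| is the Euclidean norm. -/
open scoped Real

open MeasureTheory Set

/-- The measure preserving map `(z, x, y) ↦ (x, y, z)` from `ℝ × (ℝ × ℝ)` to Euclidean space. -/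
theorem measurePreserving_toLp_vec3 :
    MeasurePreserving (fun p : ℝ × (ℝ × ℝ) ↦
      (WithLp.toLp 2 ![p.2.1, p.2.2, p.1] : EuclideanSpace ℝ (Fin 3))) := by
  have h₁ := (PiLp.volume_preserving_toLp (Fin 3)).comp
    (volume_preserving_piFinSuccAbove (fun _ : Fin 3 ↦ ℝ) 2).symm
  have h₂ := h₁.comp ((MeasurePreserving.id (volume : Measure ℝ)).prod
    (volume_preserving_finTwoArrow ℝ).symm)
  convert h₂ using 1
  · funext p
    ext i
    fin_cases i <;> rfl
  · exact Measure.volume_eq_prod _ _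

/-- Tonelli's theorem for Euclidean three-space, slicing along the last coordinate. -/
theorem lintegral_euclideanSpace_fin_three {F : EuclideanSpace ℝ (Fin 3) → ENNReal}
    (hF : Measurable F) :
    ∫⁻ u, F u = ∫⁻ z : ℝ, ∫⁻ p : ℝ × ℝ, F (WithLp.toLp 2 ![p.1, p.2, z]) := by
  rw [← measurePreserving_toLp_vec3.lintegral_comp hF, Measure.volume_eq_prod,
    lintegral_prod (fun p : ℝ × (ℝ × ℝ) ↦ F (WithLp.toLp 2 ![p.2.1, p.2.2, p.1]))
      (hF.comp measurePreserving_toLp_vec3.measurable).aemeasurable]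

/-- Integration of a radial function over the plane in polar coordinates. -/
theorem lintegral_prod_sq_add_sq {G : ℝ → ENNReal} (hG : Measurable G) :
    ∫⁻ p : ℝ × ℝ, G (p.1 ^ 2 + p.2 ^ 2) =
      ENNReal.ofReal (2 * π) * ∫⁻ r in Ioi (0 : ℝ), ENNReal.ofReal r * G (r ^ 2) := by
  have h : ∀ p : ℝ × ℝ, (polarCoord.symm p).1 ^ 2 + (polarCoord.symm p).2 ^ 2 = p.1 ^ 2 := by
    intro p
    simp only [polarCoord_symm_apply]
    linear_combination p.1 ^ 2 * Real.cos_sq_add_sin_sq p.2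
  rw [← lintegral_comp_polarCoord_symm (fun p ↦ G (p.1 ^ 2 + p.2 ^ 2))]
  simp only [h, smul_eq_mul, polarCoord_target]
  rw [Measure.volume_eq_prod, ← Measure.prod_restrict, lintegral_prod _ (by fun_prop)]
  simp only [lintegral_const, Measure.restrict_apply_univ, Real.volume_Ioo]
  rw [lintegral_mul_const _ (by fun_prop), mul_comm]
  congr 2
  ring

/-- The integral of `r / √(r² + t²)` over `(0, R)`, for `t > 0`. -/
theorem setLIntegral_div_sqrt_sq_add_sq {t R : ℝ} (ht : 0 < t) (hR : 0 ≤ R) :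
    ∫⁻ r in Ioo 0 R, ENNReal.ofReal (r / √(r ^ 2 + t ^ 2)) =
      ENNReal.ofReal (√(R ^ 2 + t ^ 2) - t) := by
  have hpos : ∀ r : ℝ, 0 < r ^ 2 + t ^ 2 := fun r ↦ by positivity
  have hcont : Continuous fun r : ℝ ↦ r / √(r ^ 2 + t ^ 2) :=
    continuous_id.div (by fun_prop) fun r ↦ (Real.sqrt_pos.2 (hpos r)).ne'
  have hderiv : ∀ r : ℝ, HasDerivAt (fun r ↦ √(r ^ 2 + t ^ 2)) (r / √(r ^ 2 + t ^ 2)) r := by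
    intro r
    have hsq : HasDerivAt (fun r : ℝ ↦ r ^ 2) (2 * r) r := by simpa using hasDerivAt_pow 2 r
    refine ((hsq.add_const (t ^ 2)).sqrt (hpos r).ne').congr_deriv ?_
    rw [mul_div_mul_left _ _ two_ne_zero]
  have hint := intervalIntegral.integral_eq_sub_of_hasDerivAt (a := 0) (b := R)
    (fun r _ ↦ hderiv r) (hcont.intervalIntegrable _ _)
  rw [intervalIntegral.integral_of_le hR] at hint
  have h0 : √((0 : ℝ) ^ 2 + t ^ 2) = t := by simp [Real.sqrt_sq ht.le]
  rw [h0] at hint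
  rw [← hint, restrict_Ioo_eq_restrict_Ioc,
    ofReal_integral_eq_lintegral_ofReal ((hcont.intervalIntegrable 0 R).1)]
  filter_upwards [ae_restrict_mem measurableSet_Ioc] with r hr
  exact div_nonneg hr.1.le (Real.sqrt_nonneg _)

/-- The integral of `√(2(1 - z)) - (1 - z)` over `(-1, 1)`. -/
theorem setLIntegral_sqrt_two_mul_one_sub :
    ∫⁻ z in Ioo (-1 : ℝ) 1, ENNReal.ofReal (√(2 * (1 - z)) - (1 - z)) =
      ENNReal.ofReal (2 / 3) := by
  have hcont : Continuous fun z : ℝ ↦ √(2 * (1 - z)) - (1 - z) := by fun_prop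
  have hint := intervalIntegral.integral_eq_sub_of_hasDerivAt_of_le (a := (-1 : ℝ)) (b := 1)
    (f := fun z ↦ -(1 / 3) * ((2 * (1 - z)) * √(2 * (1 - z))) + (1 - z) ^ 2 / 2)
    (f' := fun z ↦ √(2 * (1 - z)) - (1 - z)) (by norm_num) (by fun_prop) (by
      intro z hz
      have hz' : 0 < 2 * (1 - z) := by linarith [hz.2]
      have h₁ : HasDerivAt (fun z : ℝ ↦ 1 - z) (-1) z := by
        simpa using (hasDerivAt_id z).const_sub 1
      have h₂ : HasDerivAt (fun z : ℝ ↦ 2 * (1 - z)) (2 * -1) z := h₁.const_mul 2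
      refine (((h₂.mul (h₂.sqrt hz'.ne')).const_mul (-(1 / 3))).add
        ((h₁.pow 2).div_const 2)).congr_deriv ?_
      have hs := (Real.sqrt_pos.2 hz').ne'
      have hsq := Real.sq_sqrt hz'.le
      field_simp
      push_cast
      linear_combination -2 * hsq) (hcont.intervalIntegrable _ _)
  have h4 : √(2 * (1 - -1)) = (2 : ℝ) := by
    rw [show (2 * (1 - -1) : ℝ) = 2 ^ 2 by norm_num]
    exact Real.sqrt_sq (by norm_num)
  rw [intervalIntegral.integral_of_le (by norm_num)] at hint
  have hval : ∫ z in Ioc (-1 : ℝ) 1, (√(2 * (1 - z)) - (1 - z)) = 2 / 3 := by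
    rw [hint, h4]
    norm_num
  rw [← hval, restrict_Ioo_eq_restrict_Ioc,
    ofReal_integral_eq_lintegral_ofReal ((hcont.intervalIntegrable (-1) 1).1)]
  filter_upwards [ae_restrict_mem measurableSet_Ioc] with z hz
  exact sub_nonneg.2 (Real.le_sqrt_of_sq_le (by nlinarith [hz.1, hz.2]))

/-- The integral of the inverse distance to `e₃` over the horizontal slice of the unit ball at
height `z`. -/
theorem lintegral_slice_inv_dist (z : ℝ) :
    ∫⁻ p : ℝ × ℝ, (Iio (1 - z ^ 2)).indicator
        (fun s ↦ ENNReal.ofReal (1 / √(s + (1 - z) ^ 2))) (p.1 ^ 2 + p.2 ^ 2) =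
      (Ioo (-1 : ℝ) 1).indicator
        (fun z ↦ ENNReal.ofReal (2 * π) * ENNReal.ofReal (√(2 * (1 - z)) - (1 - z))) z := by
  rw [lintegral_prod_sq_add_sq (Measurable.indicator (by fun_prop) measurableSet_Iio)]
  by_cases hz : z ∈ Ioo (-1 : ℝ) 1
  · have hR : 0 ≤ 1 - z ^ 2 := by nlinarith [hz.1, hz.2]
    rw [indicator_of_mem hz]
    congr 1
    have h := setLIntegral_div_sqrt_sq_add_sq (sub_pos.2 hz.2) (Real.sqrt_nonneg (1 - z ^ 2))
    rw [Real.sq_sqrt hR, show 1 - z ^ 2 + (1 - z) ^ 2 = 2 * (1 - z) by ring] at h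
    rw [← h, ← lintegral_indicator measurableSet_Ioi, ← lintegral_indicator measurableSet_Ioo]
    congr 1
    funext r
    by_cases hr : 0 < r
    · by_cases hr' : r ^ 2 < 1 - z ^ 2
      · rw [indicator_of_mem (mem_Ioi.2 hr), indicator_of_mem (mem_Iio.2 hr'),
          indicator_of_mem (mem_Ioo.2 ⟨hr, Real.lt_sqrt_of_sq_lt hr'⟩), ← ENNReal.ofReal_mul hr.le,
          mul_one_div]
      · rw [indicator_of_mem (mem_Ioi.2 hr), indicator_of_notMem (by simpa using hr'),
          indicator_of_notMem, mul_zero]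
        exact fun h ↦ hr' ((Real.lt_sqrt hr.le).1 h.2)
    · rw [indicator_of_notMem (by simpa using hr), indicator_of_notMem fun h ↦ hr h.1]
  · rw [indicator_of_notMem hz]
    have hz' : 1 - z ^ 2 ≤ 0 := by
      by_contra! h
      exact hz ⟨by nlinarith, by nlinarith⟩
    have h : ∀ r : ℝ, r ^ 2 ∉ Iio (1 - z ^ 2) := fun r hr ↦ by
      have := mem_Iio.1 hr
      nlinarith [sq_nonneg r]
    simp [indicator_of_notMem (h _)]

/-- The integral over the open unit ball in `ℝ³` of `u ↦ 1/|u - e₃|`, with `e₃ = (0,0,1)`,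
equals `4π/3`. -/
theorem integral_ball_inv_dist :
    ∫ u in Metric.ball (0 : EuclideanSpace ℝ (Fin 3)) 1,
      (1 : ℝ) / ‖u - EuclideanSpace.single (2 : Fin 3) (1 : ℝ)‖ = 4 * Real.pi / 3 := by
  have hm : Measurable fun u : EuclideanSpace ℝ (Fin 3) ↦
      (1 : ℝ) / ‖u - EuclideanSpace.single (2 : Fin 3) (1 : ℝ)‖ := by fun_prop
  rw [integral_eq_lintegral_of_nonneg_ae (.of_forall fun u ↦ by positivity)
    hm.aestronglyMeasurable, ← lintegral_indicator measurableSet_ball,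
    lintegral_euclideanSpace_fin_three (hm.ennreal_ofReal.indicator measurableSet_ball)]
  have hslice : ∀ (z : ℝ) (p : ℝ × ℝ),
      (Metric.ball (0 : EuclideanSpace ℝ (Fin 3)) 1).indicator
        (fun u ↦ ENNReal.ofReal (1 / ‖u - EuclideanSpace.single (2 : Fin 3) (1 : ℝ)‖))
        (WithLp.toLp 2 ![p.1, p.2, z]) =
      (Iio (1 - z ^ 2)).indicator
        (fun s ↦ ENNReal.ofReal (1 / √(s + (1 - z) ^ 2))) (p.1 ^ 2 + p.2 ^ 2) := by
    intro z p
    have hmem : (WithLp.toLp 2 ![p.1, p.2, z] : EuclideanSpace ℝ (Fin 3)) ∈ Metric.ball 0 1 ↔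
        p.1 ^ 2 + p.2 ^ 2 ∈ Iio (1 - z ^ 2) := by
      rw [mem_ball_zero_iff, EuclideanSpace.norm_eq, Real.sqrt_lt' one_pos, mem_Iio,
        lt_sub_iff_add_lt]
      simp [Fin.sum_univ_three]
    have hnorm : ‖(WithLp.toLp 2 ![p.1, p.2, z] : EuclideanSpace ℝ (Fin 3)) -
        EuclideanSpace.single (2 : Fin 3) (1 : ℝ)‖ = √(p.1 ^ 2 + p.2 ^ 2 + (1 - z) ^ 2) := by
      rw [EuclideanSpace.norm_eq, sub_sq_comm]
      simp [Fin.sum_univ_three]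
    simp only [indicator, hmem, hnorm]
  simp only [hslice, lintegral_slice_inv_dist]
  rw [lintegral_indicator measurableSet_Ioo, lintegral_const_mul _ (by fun_prop),
    setLIntegral_sqrt_two_mul_one_sub, ← ENNReal.ofReal_mul (by positivity),
    ENNReal.toReal_ofReal (by positivity)]
  ring
end

section
/- Let X = (X_n) be a Markov chain on a finite state space V with transition matrix P, started at a state x belonging to a set C ⊆ V. Let σ = inf{ n ≥ 0 : X_n ∉ C } be the exit time of C and τ⁺ = inf{ n ≥ 1 : X_n = x } the first return time to x, and assume P_x[σ < ∞] = 1. Then, under P_x, the event {τ⁺ ≤ σ} is independent of the exit position X_σ: for every w ∈ V, P_x[ X_σ = w, τ⁺ ≤ σ ] = P_x[ X_σ = w ] · P_x[ τ⁺ ≤ σ ]. -/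
attribute [local instance] Classical.propDecidable

noncomputable section

variable {V : Type*} [Fintype V] [DecidableEq V]

/-- Weight (probability) of a finite trajectory under the transition matrix `P`. -/
def pathWeight (P : V → V → ℝ) {t : ℕ} (ω : Fin (t + 1) → V) : ℝ :=
  ∏ i : Fin t, P (ω i.castSucc) (ω i.succ)

/-- The path `ω` of length `t`, started at `x`, exits `C` exactly at time `t`
(i.e. `σ = t` where `σ = inf{n ≥ 0 : X_n ∉ C}`). -/
def ExitsAt (C : Set V) (x : V) {t : ℕ} (ω : Fin (t + 1) → V) : Prop :=
  ω 0 = x ∧ (∀ i : Fin (t + 1), (i : ℕ) < t → ω i ∈ C) ∧ ω (Fin.last t) ∉ C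

/-- `P_x[σ < ∞ and the trajectory up to time σ satisfies A]`, where `σ` is the exit time
of `C` and `A t ω` is a property of the trajectory `ω` stopped at `σ = t`. -/
def probUpToExit (P : V → V → ℝ) (C : Set V) (x : V)
    (A : ∀ t : ℕ, (Fin (t + 1) → V) → Prop) : ℝ :=
  ∑' t : ℕ, ∑ ω : Fin (t + 1) → V,
    if ExitsAt C x ω ∧ A t ω then pathWeight P ω else 0

set_option linter.unusedSectionVars false

/-- The probability, from `u`, that the chain exits `C` exactly at time `t` along a trajectory
satisfying `A`. -/
def exitSum (P : V → V → ℝ) (C : Set V) (t : ℕ) (u : V) (A : (Fin (t + 1) → V) → Prop) : ℝ :=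
  ∑ ω : Fin (t + 1) → V, if ExitsAt C u ω ∧ A ω then pathWeight P ω else 0

theorem exitSum_congr (P : V → V → ℝ) (C : Set V) (t : ℕ) (u : V)
    {A B : (Fin (t + 1) → V) → Prop} (h : ∀ ω, ExitsAt C u ω → (A ω ↔ B ω)) :
    exitSum P C t u A = exitSum P C t u B := by
  refine Finset.sum_congr rfl fun ω _ => ?_
  by_cases hω : ExitsAt C u ω
  · simp [h ω hω]
  · simp [hω]

theorem exitSum_eq_zero (P : V → V → ℝ) (C : Set V) (t : ℕ) (u : V)
    {A : (Fin (t + 1) → V) → Prop} (h : ∀ ω, ExitsAt C u ω → ¬ A ω) :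
    exitSum P C t u A = 0 := by
  refine Finset.sum_eq_zero fun ω _ => if_neg ?_
  rintro ⟨h₁, h₂⟩
  exact h ω h₁ h₂

theorem pathWeight_nonneg {P : V → V → ℝ} (hpos : ∀ u v, 0 ≤ P u v) {t : ℕ}
    (ω : Fin (t + 1) → V) : 0 ≤ pathWeight P ω :=
  Finset.prod_nonneg fun _ _ => hpos _ _

theorem exitSum_mono {P : V → V → ℝ} (hpos : ∀ u v, 0 ≤ P u v) (C : Set V) (t : ℕ) (u : V)
    {A B : (Fin (t + 1) → V) → Prop} (h : ∀ ω, A ω → B ω) :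
    exitSum P C t u A ≤ exitSum P C t u B := by
  refine Finset.sum_le_sum fun ω _ => ?_
  have := pathWeight_nonneg hpos ω
  split_ifs with h₁ h₂ h₂
  · exact le_rfl
  · exact absurd ⟨h₁.1, h ω h₁.2⟩ h₂
  · exact this
  · exact le_rfl

theorem exitSum_nonneg {P : V → V → ℝ} (hpos : ∀ u v, 0 ≤ P u v) (C : Set V) (t : ℕ) (u : V)
    (A : (Fin (t + 1) → V) → Prop) : 0 ≤ exitSum P C t u A := by
  refine Finset.sum_nonneg fun ω _ => ?_
  have := pathWeight_nonneg hpos ω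
  split_ifs <;> simp [this]

theorem exitsAt_cons (C : Set V) (u y : V) {t : ℕ} (ω : Fin (t + 1) → V) :
    ExitsAt C u (Fin.cons y ω : Fin (t + 1 + 1) → V) ↔
      y = u ∧ u ∈ C ∧ ExitsAt C (ω 0) ω := by
  unfold ExitsAt
  rw [Fin.forall_fin_succ, ← Fin.succ_last]
  simp only [Fin.cons_zero, Fin.cons_succ, Fin.val_zero, Fin.val_succ, add_lt_add_iff_right,
    true_and]
  constructor
  · rintro ⟨rfl, ⟨h₁, h₂⟩, h₃⟩
    exact ⟨rfl, h₁ (Nat.succ_pos t), h₂, h₃⟩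
  · rintro ⟨rfl, h₁, h₂, h₃⟩
    exact ⟨rfl, ⟨fun _ => h₁, h₂⟩, h₃⟩

theorem pathWeight_cons (P : V → V → ℝ) (u : V) {t : ℕ} (ω : Fin (t + 1) → V) :
    pathWeight P (Fin.cons u ω : Fin (t + 1 + 1) → V) = P u (ω 0) * pathWeight P ω := by
  unfold pathWeight
  rw [Fin.prod_univ_succ]
  simp

/-- First-step decomposition. -/
theorem exitSum_succ (P : V → V → ℝ) (C : Set V) (t : ℕ) (u : V)
    (A : (Fin (t + 1 + 1) → V) → Prop) :
    exitSum P C (t + 1) u A =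
      if u ∈ C then ∑ v, P u v * exitSum P C t v (fun ω => A (Fin.cons u ω)) else 0 := by
  have key : exitSum P C (t + 1) u A =
      ∑ ω : Fin (t + 1) → V, if u ∈ C ∧ ExitsAt C (ω 0) ω ∧ A (Fin.cons u ω) then
        P u (ω 0) * pathWeight P ω else 0 := by
    unfold exitSum
    rw [← (Fin.consEquiv fun _ : Fin (t + 1 + 1) => V).sum_comp, Fintype.sum_prod_type,
      Finset.sum_eq_single u]
    · refine Finset.sum_congr rfl fun ω _ => ?_
      change (if ExitsAt C u (Fin.cons u ω : Fin (t + 1 + 1) → V) ∧ A (Fin.cons u ω) then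
        pathWeight P (Fin.cons u ω : Fin (t + 1 + 1) → V) else 0) = _
      simp only [exitsAt_cons, pathWeight_cons, true_and, and_assoc]
    · intro y _ hy
      exact Finset.sum_eq_zero fun ω _ => if_neg fun h => hy ((exitsAt_cons C u y ω).1 h.1).1
    · simp
  rw [key]
  by_cases hu : u ∈ C
  · simp only [hu, true_and, if_true, exitSum, Finset.mul_sum]
    rw [Finset.sum_comm]
    refine Finset.sum_congr rfl fun ω _ => ?_
    rw [Finset.sum_eq_single (ω 0)]
    · simp
    · intro v _ hv
      have : ¬ ExitsAt C v ω := fun h => hv h.1.symm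
      simp [this]
    · simp
  · simp [hu]

/-- The probability, from `u`, that the first visit to `x` (at a time `≥ 0`) happens at time `k`,
before exiting `C`. -/
def firstVisit (P : V → V → ℝ) (C : Set V) (x : V) : ℕ → V → ℝ
  | 0, u => if u = x then 1 else 0
  | k + 1, u => if u ∈ C ∧ u ≠ x then ∑ v, P u v * firstVisit P C x k v else 0

/-- The probability, from `x`, that the first return to `x` happens at time `k`, before
exiting `C`. -/
def firstReturn (P : V → V → ℝ) (C : Set V) (x : V) : ℕ → ℝ
  | 0 => 0
  | k + 1 => ∑ v, P x v * firstVisit P C x k v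

theorem firstVisit_nonneg {P : V → V → ℝ} (hpos : ∀ u v, 0 ≤ P u v) (C : Set V) (x : V)
    (k : ℕ) (u : V) : 0 ≤ firstVisit P C x k u := by
  induction k generalizing u with
  | zero => unfold firstVisit; split_ifs <;> simp
  | succ k ih =>
    unfold firstVisit
    split_ifs
    · exact Finset.sum_nonneg fun v _ => mul_nonneg (hpos u v) (ih v)
    · exact le_rfl

theorem firstReturn_nonneg {P : V → V → ℝ} (hpos : ∀ u v, 0 ≤ P u v) (C : Set V) (x : V)
    (k : ℕ) : 0 ≤ firstReturn P C x k := by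
  cases k with
  | zero => exact le_rfl
  | succ k =>
    exact Finset.sum_nonneg fun v _ => mul_nonneg (hpos x v) (firstVisit_nonneg hpos C x k v)

theorem sum_mul_sum_antidiagonal (p : V → ℝ) (g : ℕ → V → ℝ) (a : ℕ → ℝ) (t : ℕ) :
    ∑ v, p v * ∑ kl ∈ Finset.HasAntidiagonal.antidiagonal t, g kl.1 v * a kl.2 =
      ∑ kl ∈ Finset.HasAntidiagonal.antidiagonal t, (∑ v, p v * g kl.1 v) * a kl.2 := by
  simp only [Finset.mul_sum, Finset.sum_mul]
  rw [Finset.sum_comm]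
  exact Finset.sum_congr rfl fun _ _ => Finset.sum_congr rfl fun _ _ => by ring

/-- Markov property at the first visit to `x`. -/
theorem exitSum_visit (P : V → V → ℝ) {C : Set V} {x : V} (hx : x ∈ C) (B : V → Prop)
    (t : ℕ) (u : V) :
    exitSum P C t u (fun ω => B (ω (Fin.last t)) ∧ ∃ n, ω n = x) =
      ∑ kl ∈ Finset.HasAntidiagonal.antidiagonal t,
        firstVisit P C x kl.1 u * exitSum P C kl.2 x (fun ω => B (ω (Fin.last kl.2))) := by
  induction t generalizing u with
  | zero =>
    rw [Finset.Nat.antidiagonal_zero, Finset.sum_singleton, exitSum_eq_zero, exitSum_eq_zero, mul_zero]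
    · rintro ω ⟨h₁, -, h₂⟩
      exact absurd (h₁ ▸ hx : ω 0 ∈ C) h₂
    · rintro ω ⟨-, -, h₂⟩ ⟨-, n, hn⟩
      rw [show n = Fin.last 0 from Fin.ext (by simp)] at hn
      exact h₂ (hn ▸ hx)
  | succ t ih =>
    rw [Finset.Nat.sum_antidiagonal_succ]
    by_cases hu : u = x
    · subst hu
      simp only [firstVisit, ne_eq, not_true_eq_false, and_false, if_false, if_true, zero_mul,
        Finset.sum_const_zero, add_zero, one_mul]
      exact exitSum_congr P C _ _ fun ω hω => and_iff_left ⟨0, hω.1⟩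
    · rw [exitSum_succ]
      by_cases hC : u ∈ C
      · have hcons : ∀ v, exitSum P C t v (fun ω =>
            B ((Fin.cons u ω : Fin (t + 1 + 1) → V) (Fin.last (t + 1))) ∧
              ∃ n, (Fin.cons u ω : Fin (t + 1 + 1) → V) n = x) =
            exitSum P C t v (fun ω => B (ω (Fin.last t)) ∧ ∃ n, ω n = x) := fun v =>
          exitSum_congr P C _ _ fun ω _ => by
            rw [← Fin.succ_last, Fin.cons_succ, Fin.exists_fin_succ]
            simp [hu]
        simp only [hcons, ih, firstVisit, hC, hu, ne_eq, not_false_eq_true, and_self, if_true,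
          if_false, zero_mul, zero_add]
        exact sum_mul_sum_antidiagonal (P u) (firstVisit P C x)
          (fun s => exitSum P C s x (fun ω => B (ω (Fin.last s)))) t
      · simp [firstVisit, hC, hu]

/-- Markov property at the first return to `x`. -/
theorem exitSum_return (P : V → V → ℝ) {C : Set V} {x : V} (hx : x ∈ C) (B : V → Prop)
    (t : ℕ) :
    exitSum P C t x
        (fun ω => B (ω (Fin.last t)) ∧ ∃ n : Fin (t + 1), 1 ≤ (n : ℕ) ∧ ω n = x) =
      ∑ kl ∈ Finset.HasAntidiagonal.antidiagonal t,
        firstReturn P C x kl.1 * exitSum P C kl.2 x (fun ω => B (ω (Fin.last kl.2))) := by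
  cases t with
  | zero =>
    rw [Finset.Nat.antidiagonal_zero, Finset.sum_singleton, exitSum_eq_zero, firstReturn, zero_mul]
    rintro ω - ⟨-, n, hn, -⟩
    omega
  | succ t =>
    rw [Finset.Nat.sum_antidiagonal_succ, exitSum_succ, if_pos hx]
    have hcons : ∀ v, exitSum P C t v (fun ω =>
        B ((Fin.cons x ω : Fin (t + 1 + 1) → V) (Fin.last (t + 1))) ∧
          ∃ n : Fin (t + 1 + 1), 1 ≤ (n : ℕ) ∧ (Fin.cons x ω : Fin (t + 1 + 1) → V) n = x) =
        exitSum P C t v (fun ω => B (ω (Fin.last t)) ∧ ∃ n, ω n = x) := fun v =>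
      exitSum_congr P C _ _ fun ω _ => by
        rw [← Fin.succ_last, Fin.cons_succ, Fin.exists_fin_succ]
        simp
    simp only [hcons, exitSum_visit P hx, firstReturn, zero_mul, zero_add]
    exact sum_mul_sum_antidiagonal (P x) (firstVisit P C x)
      (fun s => exitSum P C s x (fun ω => B (ω (Fin.last s)))) t

theorem summable_firstReturn {P : V → V → ℝ} (hpos : ∀ u v, 0 ≤ P u v) {C : Set V} {x : V}
    (hx : x ∈ C) (hs : Summable fun t => exitSum P C t x (fun _ => True)) {s : ℕ}
    (hne : exitSum P C s x (fun _ => True) ≠ 0) : Summable (firstReturn P C x) := by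
  refine (summable_mul_right_iff hne).1 (Summable.of_nonneg_of_le
    (fun k => mul_nonneg (firstReturn_nonneg hpos C x k) (exitSum_nonneg hpos C s x _))
    (fun k => ?_) ((summable_nat_add_iff s).2 hs))
  calc _ ≤ ∑ kl ∈ Finset.HasAntidiagonal.antidiagonal (k + s),
        firstReturn P C x kl.1 * exitSum P C kl.2 x (fun _ => True) :=
        Finset.single_le_sum
          (f := fun kl : ℕ × ℕ => firstReturn P C x kl.1 * exitSum P C kl.2 x (fun _ => True))
          (fun kl _ => mul_nonneg (firstReturn_nonneg hpos C x kl.1)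
            (exitSum_nonneg hpos C kl.2 x _))
          (a := (k, s)) (Finset.HasAntidiagonal.mem_antidiagonal.2 rfl)
    _ = _ := (exitSum_return P hx (fun _ => True) (k + s)).symm
    _ ≤ _ := exitSum_mono hpos C _ x fun _ _ => trivial

theorem probUpToExit_return {P : V → V → ℝ} (hpos : ∀ u v, 0 ≤ P u v) {C : Set V} {x : V}
    (hx : x ∈ C) (hexit : probUpToExit P C x (fun _ _ => True) ≠ 0) (B : V → Prop) :
    probUpToExit P C x (fun t ω =>
        B (ω (Fin.last t)) ∧ ∃ n : Fin (t + 1), 1 ≤ (n : ℕ) ∧ ω n = x) =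
      (∑' k, firstReturn P C x k) * probUpToExit P C x (fun t ω => B (ω (Fin.last t))) := by
  change (∑' t, exitSum P C t x (fun _ => True)) ≠ 0 at hexit
  have hs : Summable fun t => exitSum P C t x (fun _ => True) := by
    by_contra h
    exact hexit (tsum_eq_zero_of_not_summable h)
  obtain ⟨s, hne⟩ : ∃ s, exitSum P C s x (fun _ => True) ≠ 0 := by
    by_contra! h
    exact hexit (by simp [h])
  have hB : Summable fun t => exitSum P C t x (fun ω => B (ω (Fin.last t))) :=
    Summable.of_nonneg_of_le (fun t => exitSum_nonneg hpos C t x _)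
      (fun t => exitSum_mono hpos C t x fun _ _ => trivial) hs
  refine (tsum_congr fun t => exitSum_return P hx B t).trans ?_
  exact (tsum_mul_tsum_eq_tsum_sum_antidiagonal_of_summable_norm
    (summable_firstReturn hpos hx hs hne).norm hB.norm).symm

/-- For a finite Markov chain started at `x ∈ C` with `P_x[σ < ∞] = 1`, the event
`{τ⁺ ≤ σ}` (return to `x` before — or at the moment of — exiting `C`) is independent of the
exit position `X_σ`: for every `w`, `P_x[X_σ = w, τ⁺ ≤ σ] = P_x[X_σ = w] P_x[τ⁺ ≤ σ]`. -/
theorem return_independent_of_exit_position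
    (P : V → V → ℝ) (hpos : ∀ u v, 0 ≤ P u v) (hrow : ∀ u, ∑ v : V, P u v = 1)
    (C : Set V) (x : V) (hx : x ∈ C)
    (hexit : probUpToExit P C x (fun _ _ => True) = 1) :
    ∀ w : V,
      probUpToExit P C x
          (fun t ω => ω (Fin.last t) = w ∧ ∃ n : Fin (t + 1), 1 ≤ (n : ℕ) ∧ ω n = x) =
        probUpToExit P C x (fun t ω => ω (Fin.last t) = w) *
          probUpToExit P C x (fun t ω => ∃ n : Fin (t + 1), 1 ≤ (n : ℕ) ∧ ω n = x) := by
  intro w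
  have hne : probUpToExit P C x (fun _ _ => True) ≠ 0 := by simp [hexit]
  have htrue := probUpToExit_return hpos hx hne (fun _ => True)
  simp only [true_and] at htrue
  rw [probUpToExit_return hpos hx hne (fun v => v = w), htrue, hexit, mul_one, mul_comm]
end
end
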